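/- arXiv:1409.5514 — 2 statements merged into one kernel-verified Lean document; each statement's English description precedes it below -/
import Mathlib

section
/- Homogenization under full solvability: Assume D = ℝ^N, and for P ∈ ℝ^N let H̄(P) denote the critical value of the cell problem H(x, Du + P) = a on T^N. Let T > 0 and u₀ : ℝ^N → ℝ be bounded and Lipschitz continuous. For each ε > 0 let u^ε be a bounded viscosity solution of u_t + σ(x/ε) m(|Du|) = 0 in ℝ^N × (0,T) with u^ε(·,0) = u₀, and let u be a bounded viscosity solution of u_t + H̄(Du) = 0 in ℝ^N × (0,T) with u(·,0) = u₀. Then u^ε converges to u locally uniformly on ℝ^N × [0,T) as ε → 0⁺, i.e., for every compact set K ⊂ ℝ^N × [0,T), sup_{(x,t) ∈ K} |u^ε(x,t) − u(x,t)| → 0 as ε → 0⁺. -/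
open Set Filter MeasureTheory

noncomputable section

abbrev Euc (N : ℕ) := EuclideanSpace ℝ (Fin N)

def intVec {N : ℕ} (z : Fin N → ℤ) : Euc N :=
  (EuclideanSpace.equiv (Fin N) ℝ).symm (fun i => (z i : ℝ))

def IsZPeriodic {N : ℕ} (u : Euc N → ℝ) : Prop :=
  ∀ (x : Euc N) (z : Fin N → ℤ), u (x + intVec z) = u x

def IsZPeriodicH {N : ℕ} (H : Euc N → Euc N → ℝ) : Prop :=
  ∀ (x p : Euc N) (z : Fin N → ℤ), H (x + intVec z) p = H x p

def superDiff {N : ℕ} (u : Euc N → ℝ) (x : Euc N) : Set (Euc N) :=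
  { q | ∃ φ : Euc N → ℝ, ContDiff ℝ 1 φ ∧ IsZPeriodic φ ∧
        (∀ y, u y - φ y ≤ u x - φ x) ∧ q = gradient φ x }

def subDiff {N : ℕ} (u : Euc N → ℝ) (x : Euc N) : Set (Euc N) :=
  { q | ∃ φ : Euc N → ℝ, ContDiff ℝ 1 φ ∧ IsZPeriodic φ ∧
        (∀ y, u x - φ x ≤ u y - φ y) ∧ q = gradient φ x }

def IsCellSubsolution {N : ℕ} (H : Euc N → Euc N → ℝ) (P : Euc N) (a : ℝ) (u : Euc N → ℝ) : Prop :=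
  ∀ x, ∀ q ∈ superDiff u x, H x (q + P) ≤ a

def IsCellSupersolution {N : ℕ} (H : Euc N → Euc N → ℝ) (P : Euc N) (a : ℝ) (u : Euc N → ℝ) : Prop :=
  ∀ x, ∀ q ∈ subDiff u x, a ≤ H x (q + P)

def IsCellSolution {N : ℕ} (H : Euc N → Euc N → ℝ) (P : Euc N) (u : Euc N → ℝ) (a : ℝ) : Prop :=
  (∃ K : NNReal, LipschitzWith K u) ∧ IsZPeriodic u ∧
    IsCellSubsolution H P a u ∧ IsCellSupersolution H P a u

def IsCoerciveH {N : ℕ} (H : Euc N → Euc N → ℝ) : Prop :=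
  ∀ C : ℝ, ∃ r : ℝ, ∀ x p : Euc N, r ≤ ‖p‖ → C ≤ H x p

def IsLocParaMax {N : ℕ} (T : ℝ) (w φ : Euc N → ℝ → ℝ) (x₀ : Euc N) (t₀ : ℝ) : Prop :=
  ∃ δ > (0:ℝ), ∀ (y : Euc N) (s : ℝ), ‖y - x₀‖ < δ → |s - t₀| < δ → 0 < s → s < T →
    w y s - φ y s ≤ w x₀ t₀ - φ x₀ t₀

def IsLocParaMin {N : ℕ} (T : ℝ) (w φ : Euc N → ℝ → ℝ) (x₀ : Euc N) (t₀ : ℝ) : Prop :=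
  ∃ δ > (0:ℝ), ∀ (y : Euc N) (s : ℝ), ‖y - x₀‖ < δ → |s - t₀| < δ → 0 < s → s < T →
    w x₀ t₀ - φ x₀ t₀ ≤ w y s - φ y s

/-- A bounded viscosity solution of `w_t + G(x, Dw) = 0` in `ℝ^N × (0,T)`
with initial datum `u₀`. -/
def IsParabolicSolution {N : ℕ} (G : Euc N → Euc N → ℝ) (u₀ : Euc N → ℝ) (T : ℝ)
    (w : Euc N → ℝ → ℝ) : Prop :=
  (∀ x, w x 0 = u₀ x) ∧
  ContinuousOn (fun q : Euc N × ℝ => w q.1 q.2) { q : Euc N × ℝ | 0 ≤ q.2 ∧ q.2 < T } ∧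
  (∃ M : ℝ, ∀ (x : Euc N) (t : ℝ), 0 ≤ t → t < T → |w x t| ≤ M) ∧
  (∀ φ : Euc N → ℝ → ℝ, ContDiff ℝ 1 (fun q : Euc N × ℝ => φ q.1 q.2) →
    ∀ (x₀ : Euc N) (t₀ : ℝ), 0 < t₀ → t₀ < T → IsLocParaMax T w φ x₀ t₀ →
      deriv (φ x₀) t₀ + G x₀ (gradient (fun y => φ y t₀) x₀) ≤ 0) ∧
  (∀ φ : Euc N → ℝ → ℝ, ContDiff ℝ 1 (fun q : Euc N × ℝ => φ q.1 q.2) →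
    ∀ (x₀ : Euc N) (t₀ : ℝ), 0 < t₀ → t₀ < T → IsLocParaMin T w φ x₀ t₀ →
      0 ≤ deriv (φ x₀) t₀ + G x₀ (gradient (fun y => φ y t₀) x₀))

/-! ### Gradient calculus -/

theorem HasGradientAt.fun_add {N : ℕ} {f g : Euc N → ℝ} {a b x : Euc N}
    (hf : HasGradientAt f a x) (hg : HasGradientAt g b x) :
    HasGradientAt (fun y => f y + g y) (a + b) x := by
  rw [hasGradientAt_iff_hasFDerivAt] at *
  simpa using! hf.add hg

theorem HasGradientAt.fun_const_mul {N : ℕ} {f : Euc N → ℝ} {a x : Euc N}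
    (hf : HasGradientAt f a x) (c : ℝ) :
    HasGradientAt (fun y => c * f y) (c • a) x := by
  rw [hasGradientAt_iff_hasFDerivAt] at *
  simpa using! hf.const_mul c

theorem HasGradientAt.comp_smul_sub {N : ℕ} {f : Euc N → ℝ} {a x : Euc N} (c : ℝ) (b : Euc N)
    (hf : HasGradientAt f a (c • x - b)) :
    HasGradientAt (fun y => f (c • y - b)) (c • a) x := by
  rw [hasGradientAt_iff_hasFDerivAt] at *
  have h : HasFDerivAt (fun y : Euc N => c • y - b) (c • ContinuousLinearMap.id ℝ (Euc N)) x :=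
    ((hasFDerivAt_id x).const_smul c).sub_const b
  refine HasFDerivAt.congr_fderiv (hf.comp x h) ?_
  ext y
  simp

theorem HasGradientAt.norm_sub_sq {N : ℕ} (b x : Euc N) :
    HasGradientAt (fun y => ‖y - b‖ ^ 2) ((2 : ℝ) • (x - b)) x := by
  rw [hasGradientAt_iff_hasFDerivAt]
  refine HasFDerivAt.congr_fderiv ((hasFDerivAt_id (𝕜 := ℝ) x).sub_const b).norm_sq ?_
  ext y
  simp

theorem gradient_neg {N : ℕ} (f : Euc N → ℝ) (x : Euc N) :
    gradient (fun y => -f y) x = -gradient f x := by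
  simp [gradient, fderiv_fun_neg]

/-! ### A smooth periodic penalization -/

/-- A smooth `ℤ^N`-periodic function vanishing exactly on `ℤ^N`. -/
def perPen {N : ℕ} (h : Euc N) : ℝ := ∑ i, Real.sin (Real.pi * h i) ^ 2

theorem perPen_nonneg {N : ℕ} (h : Euc N) : 0 ≤ perPen h :=
  Finset.sum_nonneg fun _ _ => sq_nonneg _

theorem perPen_zero {N : ℕ} : perPen (0 : Euc N) = 0 := by simp [perPen]

theorem intVec_apply {N : ℕ} (z : Fin N → ℤ) (i : Fin N) : intVec z i = z i := rfl

theorem perPen_periodic {N : ℕ} : IsZPeriodic (perPen (N := N)) := by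
  intro x z
  unfold perPen
  refine Finset.sum_congr rfl fun i _ => ?_
  have : Real.pi * (x + intVec z) i = Real.pi * x i + z i * Real.pi := by
    simp [intVec_apply]; ring
  rw [this, Real.sin_add_int_mul_pi, mul_pow]
  have : ((-1 : ℝ) ^ (z i)) ^ 2 = 1 := by
    rw [← zpow_natCast, ← zpow_mul, mul_comm, zpow_mul]; simp
  rw [this, one_mul]

theorem perPen_contDiff {N : ℕ} : ContDiff ℝ 1 (perPen (N := N)) := by
  unfold perPen
  fun_prop

theorem perPen_hasGradientAt {N : ℕ} (h : Euc N) :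
    HasGradientAt perPen (gradient perPen h) h :=
  ((perPen_contDiff.differentiable (by norm_num)) h).hasGradientAt

theorem exists_intVec_norm_sq_le_perPen {N : ℕ} (h : Euc N) :
    ∃ z : Fin N → ℤ, 4 * ‖h + intVec z‖ ^ 2 ≤ perPen h ∧ ‖h + intVec z‖ ^ 2 ≤ N := by
  refine ⟨fun i => -round (h i), ?_, ?_⟩
  · rw [← perPen_periodic h (fun i => -round (h i)), EuclideanSpace.real_norm_sq_eq, perPen,
      Finset.mul_sum]
    refine Finset.sum_le_sum fun i _ => ?_
    have e : (h + intVec (fun i => -round (h i))) i = h i - round (h i) := by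
      simp [intVec_apply]; ring
    rw [e]
    have h1 := abs_sub_round (h i)
    set r := h i - round (h i)
    have h2 : |Real.pi * r| ≤ Real.pi / 2 := by
      rw [abs_mul, abs_of_pos Real.pi_pos]
      nlinarith [Real.pi_pos]
    have h3 := Real.mul_abs_le_abs_sin h2
    rw [abs_mul, abs_of_pos Real.pi_pos, ← mul_assoc, div_mul_cancel₀ _ Real.pi_ne_zero] at h3
    rw [← sq_abs r, ← sq_abs (Real.sin _)]
    nlinarith [abs_nonneg r]
  · rw [EuclideanSpace.real_norm_sq_eq]
    calc _ ≤ ∑ i : Fin N, (1 : ℝ) := Finset.sum_le_sum fun i _ => by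
          have e : (h + intVec (fun i => -round (h i))) i = h i - round (h i) := by
            simp [intVec_apply]; ring
          rw [e, ← sq_abs]
          have h1 := abs_sub_round (h i)
          nlinarith [abs_nonneg (h i - round (h i))]
      _ = N := by simp

theorem exists_add_intVec_mem_closedBall {N : ℕ} (h : Euc N) :
    ∃ z : Fin N → ℤ, h + intVec z ∈ Metric.closedBall (0 : Euc N) (Real.sqrt N) := by
  obtain ⟨z, -, hz⟩ := exists_intVec_norm_sq_le_perPen h
  refine ⟨z, ?_⟩
  rw [mem_closedBall_zero_iff]
  exact Real.le_sqrt_of_sq_le hz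

theorem intVec_neg {N : ℕ} (z : Fin N → ℤ) : intVec (-z) = -intVec z := by
  ext i; simp [intVec_apply]

theorem IsZPeriodic.sub_intVec {N : ℕ} {f : Euc N → ℝ} (hf : IsZPeriodic f) (x : Euc N)
    (z : Fin N → ℤ) : f (x - intVec z) = f x := by
  rw [sub_eq_add_neg, ← intVec_neg, hf]

theorem IsZPeriodic.exists_forall_le {N : ℕ} {f : Euc N → ℝ} (hf : IsZPeriodic f)
    (hc : Continuous f) : ∃ x, ∀ y, f y ≤ f x := by
  obtain ⟨x, -, hx⟩ := (isCompact_closedBall (0 : Euc N) (Real.sqrt N)).exists_isMaxOn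
    ⟨0, by simp⟩ hc.continuousOn
  refine ⟨x, fun y => ?_⟩
  obtain ⟨z, hz⟩ := exists_add_intVec_mem_closedBall y
  rw [← hf y z]
  exact hx hz

theorem IsZPeriodic.neg {N : ℕ} {f : Euc N → ℝ} (hf : IsZPeriodic f) :
    IsZPeriodic (fun x => -f x) := fun x z => congrArg Neg.neg (hf x z)

theorem IsZPeriodic.exists_abs_le {N : ℕ} {f : Euc N → ℝ} (hf : IsZPeriodic f)
    (hc : Continuous f) : ∃ V, 0 ≤ V ∧ ∀ y, |f y| ≤ V := by
  obtain ⟨x, hx⟩ := hf.exists_forall_le hc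
  obtain ⟨x', hx'⟩ := hf.neg.exists_forall_le hc.neg
  refine ⟨max |f x'| |f x|, le_max_of_le_left (abs_nonneg _), fun y => ?_⟩
  exact abs_le_max_abs_abs (by linarith [hx' y]) (hx y)

/-- A continuous periodic function is uniformly continuous modulo `ℤ^N`. -/
theorem IsZPeriodic.exists_perPen_modulus {N : ℕ} {f : Euc N → ℝ} (hf : IsZPeriodic f)
    (hc : Continuous f) {e : ℝ} (he : 0 < e) :
    ∃ d > 0, ∀ x y, perPen (x - y) ≤ d → |f x - f y| ≤ e := by
  have huc := (isCompact_closedBall (0 : Euc N) (Real.sqrt N + 1)).uniformContinuousOn_of_continuous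
    hc.continuousOn
  rw [Metric.uniformContinuousOn_iff] at huc
  obtain ⟨r, hr, H⟩ := huc e he
  refine ⟨min r 1 ^ 2, by positivity, fun x y hxy => ?_⟩
  have hm : 0 < min r 1 := by positivity
  obtain ⟨n, hn⟩ := exists_add_intVec_mem_closedBall y
  obtain ⟨z, hz, -⟩ := exists_intVec_norm_sq_le_perPen (x - y)
  have h1 : ‖x - y + intVec z‖ < min r 1 := by
    by_contra! h
    nlinarith
  rw [mem_closedBall_zero_iff] at hn
  have h2 : dist (x + intVec z + intVec n) (y + intVec n) < min r 1 := by
    have e : x + intVec z + intVec n - (y + intVec n) = x - y + intVec z := by module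
    rw [dist_eq_norm, e]
    exact h1
  have h3 := H (x + intVec z + intVec n) (by
      rw [mem_closedBall_zero_iff]
      rw [dist_eq_norm] at h2
      have := norm_le_norm_add_norm_sub' (x + intVec z + intVec n) (y + intVec n)
      linarith [min_le_right r 1]) (y + intVec n) (by
      rw [mem_closedBall_zero_iff]; linarith) (h2.trans_le (min_le_left _ _))
  rw [hf, hf, hf, Real.dist_eq] at h3
  exact h3.le

theorem hasGradientAt_perPen_left {N : ℕ} (κ c : ℝ) (x z : Euc N) :
    HasGradientAt (fun y => κ * perPen (c • y - z)) (κ • c • gradient perPen (c • x - z)) x :=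
  ((perPen_hasGradientAt _).comp_smul_sub c z).fun_const_mul κ

theorem hasGradientAt_perPen_right {N : ℕ} (κ : ℝ) (a z : Euc N) :
    HasGradientAt (fun y => -κ * perPen (a - y)) (κ • gradient perPen (a - z)) z := by
  have h := hasGradientAt_perPen_left (-κ) (-1) z (-a)
  have e : ∀ y : Euc N, (-1 : ℝ) • y - -a = a - y := fun y => by module
  simp only [e] at h
  convert h using 1
  module

theorem gradient_perPen_mem_subDiff {N : ℕ} {v : Euc N → ℝ} {κ : ℝ} {a z : Euc N}
    (h : ∀ y, v z + κ * perPen (a - z) ≤ v y + κ * perPen (a - y)) :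
    κ • gradient perPen (a - z) ∈ subDiff v z := by
  refine ⟨fun y => -κ * perPen (a - y), ?_, fun y n => ?_, fun y => ?_,
    (hasGradientAt_perPen_right κ a z).gradient.symm⟩
  · exact contDiff_const.mul (perPen_contDiff.comp (contDiff_const.sub contDiff_id))
  · have : a - (y + intVec n) = a - y - intVec n := by module
    simp only [this, perPen_periodic.sub_intVec]
  · linarith [h y]

theorem gradient_perPen_mem_superDiff {N : ℕ} {u : Euc N → ℝ} {κ : ℝ} {x z : Euc N}
    (h : ∀ y, u y - κ * perPen (y - z) ≤ u x - κ * perPen (x - z)) :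
    κ • gradient perPen (x - z) ∈ superDiff u x := by
  refine ⟨fun y => κ * perPen (y - z), ?_, fun y n => ?_, h, ?_⟩
  · exact contDiff_const.mul (perPen_contDiff.comp (contDiff_id.sub contDiff_const))
  · have : y + intVec n - z = y - z + intVec n := by module
    simp only [this, perPen_periodic _ n]
  · have h := hasGradientAt_perPen_left κ 1 x z
    simp only [one_smul] at h
    exact h.gradient.symm

/-! ### The cell problem -/

/-- Continuity of a Hamiltonian in the space variable modulo `ℤ^N`, uniformly in the momentum. -/
def IsPerUnifContH {N : ℕ} (G : Euc N → Euc N → ℝ) : Prop :=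
  ∀ e > 0, ∃ d > 0, ∀ x z p, perPen (x - z) ≤ d → |G x p - G z p| ≤ e

theorem cell_comparison {N : ℕ} {G : Euc N → Euc N → ℝ} {L : ℝ}
    (hLip : ∀ x p q, |G x p - G x q| ≤ L * ‖p - q‖) (hmod : IsPerUnifContH G)
    {u v : Euc N → ℝ} (huc : Continuous u) (hvc : Continuous v)
    (hup : IsZPeriodic u) (hvp : IsZPeriodic v) {P Q : Euc N} {a b : ℝ}
    (hu : IsCellSubsolution G P a u) (hv : IsCellSupersolution G Q b v) :
    b ≤ a + L * ‖P - Q‖ := by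
  refine le_of_forall_pos_le_add fun e he => ?_
  obtain ⟨d, hd, H⟩ := hmod e he
  obtain ⟨V, hV0, hV⟩ := hvp.exists_abs_le hvc
  set κ : ℝ := (2 * V + 1) / d with hκ
  have hκ0 : 0 < κ := by positivity
  set B := Metric.closedBall (0 : Euc N) (Real.sqrt N)
  have hB : IsCompact B := isCompact_closedBall _ _
  have hpc : Continuous (perPen (N := N)) := perPen_contDiff.continuous
  have hcont : Continuous fun q : Euc N × Euc N => u q.1 - v q.2 - κ * perPen (q.1 - q.2) := by
    fun_prop
  obtain ⟨⟨x, z⟩, -, hmax⟩ := (hB.prod hB).exists_isMaxOn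
    ⟨(0, 0), by simp [B]⟩ hcont.continuousOn
  have key : ∀ x' z', u x' - v z' - κ * perPen (x' - z') ≤ u x - v z - κ * perPen (x - z) := by
    intro x' z'
    obtain ⟨n, hn⟩ := exists_add_intVec_mem_closedBall x'
    obtain ⟨l, hl⟩ := exists_add_intVec_mem_closedBall z'
    have := hmax (show (x' + intVec n, z' + intVec l) ∈ B ×ˢ B from ⟨hn, hl⟩)
    have e : x' + intVec n - (z' + intVec l) = x' - z' + intVec n - intVec l := by module
    simpa only [mem_ofPred_eq, e, perPen_periodic.sub_intVec, perPen_periodic _ n, hup _ n,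
      hvp _ l] using this
  have h1 := hu x _ (gradient_perPen_mem_superDiff (κ := κ) (z := z)
    fun y => by linarith [key y z])
  have h2 := hv z _ (gradient_perPen_mem_subDiff (κ := κ) (a := x)
    fun y => by linarith [key x y])
  have h3 : perPen (x - z) ≤ d := by
    have := key x x
    rw [sub_self, perPen_zero] at this
    have h4 : κ * perPen (x - z) ≤ κ * d := by
      rw [hκ, div_mul_cancel₀ _ hd.ne', ← hκ]
      linarith [abs_le.1 (hV x), abs_le.1 (hV z)]
    exact le_of_mul_le_mul_left h4 hκ0
  set q := κ • gradient perPen (x - z)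
  have h4 := abs_le.1 (H x z (q + Q) h3)
  have h5 := abs_le.1 (hLip x (q + P) (q + Q))
  rw [show q + P - (q + Q) = P - Q by module] at h5
  linarith

theorem zero_mem_superDiff {N : ℕ} {u : Euc N → ℝ} {x : Euc N} (h : ∀ y, u y ≤ u x) :
    (0 : Euc N) ∈ superDiff u x :=
  ⟨fun _ => 0, contDiff_const, fun _ _ => rfl, by simpa using h, by simp⟩

theorem zero_mem_subDiff {N : ℕ} {u : Euc N → ℝ} {x : Euc N} (h : ∀ y, u x ≤ u y) :
    (0 : Euc N) ∈ subDiff u x :=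
  ⟨fun _ => 0, contDiff_const, fun _ _ => rfl, by simpa using h, by simp⟩

theorem IsCellSolution.abs_le {N : ℕ} {G : Euc N → Euc N → ℝ} {C : ℝ}
    (hC : ∀ x p, |G x p| ≤ C) {P : Euc N} {u : Euc N → ℝ} {a : ℝ}
    (h : IsCellSolution G P u a) : |a| ≤ C := by
  obtain ⟨⟨K, hK⟩, hp, hsub, hsup⟩ := h
  obtain ⟨x, hx⟩ := hp.exists_forall_le hK.continuous
  obtain ⟨y, hy⟩ := hp.neg.exists_forall_le hK.continuous.neg
  have h1 := hsub x 0 (zero_mem_superDiff hx)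
  have h2 := hsup y 0 (zero_mem_subDiff fun z => by linarith [hy z])
  exact _root_.abs_le.2 ⟨by linarith [_root_.abs_le.1 (hC x (0 + P))],
    by linarith [_root_.abs_le.1 (hC y (0 + P))]⟩

theorem IsCellSubsolution.neg {N : ℕ} {G : Euc N → Euc N → ℝ} {P : Euc N} {a : ℝ}
    {u : Euc N → ℝ} (h : IsCellSubsolution G P a u) :
    IsCellSupersolution (fun x p => -G x (-p)) (-P) (-a) (fun x => -u x) := by
  rintro x q ⟨φ, hφ, hφp, hmin, rfl⟩
  have := h x (-gradient φ x) ⟨fun y => -φ y, hφ.neg, hφp.neg, fun y => by linarith [hmin y],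
    (gradient_neg φ x).symm⟩
  change -a ≤ -G x (-(gradient φ x + -P))
  rw [show -(gradient φ x + -P) = -gradient φ x + P by module]
  linarith

/-! ### Evolution equations -/

/-- Viscosity subsolutions of `w_t + G(x, Dw) = 0`, tested with sums `A(x) + B(t)`. -/
def IsParaSub {N : ℕ} (G : Euc N → Euc N → ℝ) (T : ℝ) (w : Euc N → ℝ → ℝ) : Prop :=
  ∀ (A : Euc N → ℝ) (B : ℝ → ℝ), ContDiff ℝ 1 A → ContDiff ℝ 1 B →
    ∀ (x₀ : Euc N) (t₀ : ℝ), 0 < t₀ → t₀ < T →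
      IsLocParaMax T w (fun x t => A x + B t) x₀ t₀ →
        deriv B t₀ + G x₀ (gradient A x₀) ≤ 0

/-- Viscosity supersolutions of `w_t + G(x, Dw) = 0`, tested with sums `A(x) + B(t)`. -/
def IsParaSuper {N : ℕ} (G : Euc N → Euc N → ℝ) (T : ℝ) (w : Euc N → ℝ → ℝ) : Prop :=
  ∀ (A : Euc N → ℝ) (B : ℝ → ℝ), ContDiff ℝ 1 A → ContDiff ℝ 1 B →
    ∀ (x₀ : Euc N) (t₀ : ℝ), 0 < t₀ → t₀ < T →
      IsLocParaMin T w (fun x t => A x + B t) x₀ t₀ →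
        0 ≤ deriv B t₀ + G x₀ (gradient A x₀)

theorem deriv_gradient_add {N : ℕ} (A : Euc N → ℝ) (B : ℝ → ℝ) (x : Euc N) (t : ℝ) :
    deriv ((fun x t => A x + B t) x) t = deriv B t ∧
      gradient (fun y => (fun x t => A x + B t) y t) x = gradient A x := by
  simp [gradient]

theorem IsParabolicSolution.isParaSub {N : ℕ} {G : Euc N → Euc N → ℝ} {u₀ : Euc N → ℝ} {T : ℝ}
    {w : Euc N → ℝ → ℝ} (h : IsParabolicSolution G u₀ T w) : IsParaSub G T w := by
  intro A B hA hB x₀ t₀ h0 hT hm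
  have := h.2.2.2.1 (fun x t => A x + B t) (by fun_prop) x₀ t₀ h0 hT hm
  rwa [(deriv_gradient_add A B x₀ t₀).1, (deriv_gradient_add A B x₀ t₀).2] at this

theorem IsParabolicSolution.isParaSuper {N : ℕ} {G : Euc N → Euc N → ℝ} {u₀ : Euc N → ℝ} {T : ℝ}
    {w : Euc N → ℝ → ℝ} (h : IsParabolicSolution G u₀ T w) : IsParaSuper G T w := by
  intro A B hA hB x₀ t₀ h0 hT hm
  have := h.2.2.2.2 (fun x t => A x + B t) (by fun_prop) x₀ t₀ h0 hT hm
  rwa [(deriv_gradient_add A B x₀ t₀).1, (deriv_gradient_add A B x₀ t₀).2] at this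

theorem IsParaSuper.neg {N : ℕ} {G : Euc N → Euc N → ℝ} {T : ℝ} {w : Euc N → ℝ → ℝ}
    (h : IsParaSuper G T w) :
    IsParaSub (fun x p => -G x (-p)) T (fun x t => -w x t) := by
  rintro A B hA hB x₀ t₀ h0 hT ⟨δ, hδ, hm⟩
  have := h (fun x => -A x) (fun t => -B t) hA.neg hB.neg x₀ t₀ h0 hT
    ⟨δ, hδ, fun y s h1 h2 h3 h4 => by linarith [hm y s h1 h2 h3 h4]⟩
  rw [gradient_neg, deriv.fun_neg] at this
  linarith

theorem IsParaSub.neg {N : ℕ} {G : Euc N → Euc N → ℝ} {T : ℝ} {w : Euc N → ℝ → ℝ}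
    (h : IsParaSub G T w) :
    IsParaSuper (fun x p => -G x (-p)) T (fun x t => -w x t) := by
  rintro A B hA hB x₀ t₀ h0 hT ⟨δ, hδ, hm⟩
  have := h (fun x => -A x) (fun t => -B t) hA.neg hB.neg x₀ t₀ h0 hT
    ⟨δ, hδ, fun y s h1 h2 h3 h4 => by linarith [hm y s h1 h2 h3 h4]⟩
  rw [gradient_neg, deriv.fun_neg] at this
  linarith

theorem isLocParaMax_of_forall_le {N : ℕ} {T R τ : ℝ} {w φ : Euc N → ℝ → ℝ} {c x : Euc N} {t : ℝ}
    (hx : ‖x - c‖ < R) (ht : t < τ)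
    (h : ∀ y s, ‖y - c‖ ≤ R → 0 ≤ s → s ≤ τ → w y s - φ y s ≤ w x t - φ x t) :
    IsLocParaMax T w φ x t := by
  refine ⟨min (R - ‖x - c‖) (τ - t), lt_min (by linarith) (by linarith),
    fun y s hy hs hs0 _ => h y s ?_ hs0.le ?_⟩
  · have := norm_add_le (y - x) (x - c)
    rw [sub_add_sub_cancel] at this
    linarith [hy.trans_le (min_le_left _ _)]
  · linarith [le_abs_self (s - t), hs.trans_le (min_le_right _ _)]

theorem isLocParaMin_of_forall_le {N : ℕ} {T R τ : ℝ} {w φ : Euc N → ℝ → ℝ} {c x : Euc N} {t : ℝ}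
    (hx : ‖x - c‖ < R) (ht : t < τ)
    (h : ∀ y s, ‖y - c‖ ≤ R → 0 ≤ s → s ≤ τ → w x t - φ x t ≤ w y s - φ y s) :
    IsLocParaMin T w φ x t := by
  refine ⟨min (R - ‖x - c‖) (τ - t), lt_min (by linarith) (by linarith),
    fun y s hy hs hs0 _ => h y s ?_ hs0.le ?_⟩
  · have := norm_add_le (y - x) (x - c)
    rw [sub_add_sub_cancel] at this
    linarith [hy.trans_le (min_le_left _ _)]
  · linarith [le_abs_self (s - t), hs.trans_le (min_le_right _ _)]

/-- A smooth strictly increasing function that is small up to time `τ` and large at time `τ'`. -/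
theorem exists_time_barrier {a τ τ' : ℝ} (ha : 0 < a) (hτ : τ < τ') (B : ℝ) :
    ∃ g : ℝ → ℝ, ∃ μ > 0, ContDiff ℝ 1 g ∧ (∀ t, 0 ≤ g t) ∧ (∀ t ≤ τ, g t ≤ a) ∧ B ≤ g τ' ∧
      ∀ t, 0 ≤ t → μ ≤ deriv g t := by
  set l : ℝ := (|B| + 1) / (a * (τ' - τ)) with hl
  have hd : 0 < τ' - τ := by linarith
  have hl0 : 0 < l := by positivity
  have hder : ∀ t, HasDerivAt (fun t => a * Real.exp (l * (t - τ)))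
      (a * (Real.exp (l * (t - τ)) * l)) t := fun t => by
    have h1 : HasDerivAt (fun t : ℝ => l * (t - τ)) l t := by
      simpa using ((hasDerivAt_id t).sub_const τ).const_mul l
    exact h1.exp.const_mul a
  refine ⟨fun t => a * Real.exp (l * (t - τ)), a * (Real.exp (l * (0 - τ)) * l), by positivity,
    by fun_prop, fun t => by positivity, fun t ht => ?_, ?_, fun t ht => ?_⟩
  · have : Real.exp (l * (t - τ)) ≤ 1 := Real.exp_le_one_iff.2 (by nlinarith)
    nlinarith
  · have h1 := Real.add_one_le_exp (l * (τ' - τ))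
    have h2 : a * (l * (τ' - τ)) = |B| + 1 := by
      rw [hl]; field_simp
    have h3 : a * (l * (τ' - τ) + 1) ≤ a * Real.exp (l * (τ' - τ)) := by gcongr
    linarith [le_abs_self B]
  · rw [(hder t).deriv]
    gcongr

theorem mul_sub_mul_sq_le {K c r a : ℝ} (hc : 0 < c) (h : K ^ 2 ≤ 4 * c * a) :
    K * r - c * r ^ 2 ≤ a := by
  have : 4 * c * (K * r - c * r ^ 2) ≤ 4 * c * a := by nlinarith [sq_nonneg (K - 2 * c * r)]
  exact le_of_mul_le_mul_left this (by positivity)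

theorem IsParaSub.le_add_mul {N : ℕ} {G : Euc N → Euc N → ℝ} {T C K M : ℝ}
    {w : Euc N → ℝ → ℝ} (hw : IsParaSub G T w) (hC : 0 ≤ C) (hG : ∀ x p, -C ≤ G x p)
    (hc : ContinuousOn (fun q : Euc N × ℝ => w q.1 q.2) {q | 0 ≤ q.2 ∧ q.2 < T})
    (hM : ∀ x t, 0 ≤ t → t < T → w x t ≤ M)
    (hK : ∀ x y, w x 0 - w y 0 ≤ K * ‖x - y‖) (x₀ : Euc N) (t₁ : ℝ) (h0 : 0 ≤ t₁) (hT : t₁ < T) :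
    w x₀ t₁ ≤ w x₀ 0 + C * t₁ := by
  refine le_of_forall_pos_le_add fun e he => ?_
  by_contra! hlt
  set a := e / 4 with ha
  have ha0 : 0 < a := by positivity
  set τ := (t₁ + T) / 2 with hτ
  obtain ⟨g, μ, hμ, hgc, hg0, hga, hgB, hgd⟩ :=
    exists_time_barrier ha0 (show t₁ < τ by linarith) (|M| + |w x₀ 0|)
  set c : ℝ := K ^ 2 / (4 * a) + 1 with hcdef
  have hc0 : 0 < c := by positivity
  have hc1 : 1 ≤ c := by rw [hcdef]; linarith [show 0 ≤ K ^ 2 / (4 * a) by positivity]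
  have hKc : K ^ 2 ≤ 4 * c * a := by
    rw [hcdef]
    have : 4 * (K ^ 2 / (4 * a) + 1) * a = K ^ 2 + 4 * a := by field_simp
    linarith
  set R : ℝ := |M| + |w x₀ 0| + 1 with hR
  have hR1 : 1 ≤ R := by linarith [abs_nonneg M, abs_nonneg (w x₀ 0)]
  set S : Set (Euc N × ℝ) := Metric.closedBall x₀ R ×ˢ Icc 0 τ with hS
  have hScomp : IsCompact S := (isCompact_closedBall _ _).prod isCompact_Icc
  have hcont : ContinuousOn (fun q : Euc N × ℝ =>
      w q.1 q.2 - (c * ‖q.1 - x₀‖ ^ 2 + (C * q.2 + g q.2))) S := by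
    refine ContinuousOn.sub (hc.mono ?_) ?_
    · rintro ⟨x, t⟩ ⟨-, ht⟩
      exact ⟨ht.1, by linarith [ht.2]⟩
    · have := hgc.continuous
      fun_prop
  obtain ⟨⟨x, t⟩, ⟨hxS, htS⟩, hmax⟩ := hScomp.exists_isMaxOn
    ⟨(x₀, t₁), by simp only [hS, mem_prod, Metric.mem_closedBall, dist_self, mem_Icc]; exact
      ⟨by linarith, h0, by linarith⟩⟩ hcont
  have key : ∀ y s, ‖y - x₀‖ ≤ R → 0 ≤ s → s ≤ τ →
      w y s - (c * ‖y - x₀‖ ^ 2 + (C * s + g s)) ≤ w x t - (c * ‖x - x₀‖ ^ 2 + (C * t + g t)) :=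
    fun y s hy hs hs' => hmax (show (y, s) ∈ S from ⟨by rwa [mem_closedBall_iff_norm], hs, hs'⟩)
  rw [mem_closedBall_iff_norm] at hxS
  obtain ⟨ht0, htτ⟩ := htS
  simp only at hxS ht0 htτ
  have hlow := key x₀ t₁ (by simp; linarith) h0 (by linarith)
  simp only [sub_self, norm_zero, ne_eq, OfNat.ofNat_ne_zero, not_false_eq_true, zero_pow,
    mul_zero, zero_add] at hlow
  have hlow2 : w x₀ 0 + a < w x t - (c * ‖x - x₀‖ ^ 2 + (C * t + g t)) := by
    linarith [hga t₁ le_rfl]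
  have hCt : 0 ≤ C * t := mul_nonneg hC ht0
  have hwM := hM x t ht0 (by linarith)
  have hcx : 0 ≤ c * ‖x - x₀‖ ^ 2 := by positivity
  have hb1 : ‖x - x₀‖ < R := by
    by_contra! h
    have : R ≤ c * ‖x - x₀‖ ^ 2 := by nlinarith
    linarith [hg0 t, le_abs_self M, neg_abs_le (w x₀ 0)]
  have hb2 : 0 < t := by
    rcases ht0.lt_or_eq with h | h
    · exact h
    · rw [← h] at hlow2
      linarith [hK x x₀, mul_sub_mul_sq_le (r := ‖x - x₀‖) hc0 hKc, hg0 0]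
  have hb3 : t < τ := by
    rcases htτ.lt_or_eq with h | h
    · exact h
    · rw [← h] at hgB
      linarith [le_abs_self M, neg_abs_le (w x₀ 0)]
  have hfin := hw (fun y => c * ‖y - x₀‖ ^ 2) (fun s => C * s + g s)
    (contDiff_const.mul ((contDiff_id.sub contDiff_const).norm_sq ℝ)) (by fun_prop) x t hb2
    (by linarith) (isLocParaMax_of_forall_le hb1 hb3 key)
  have hd : deriv (fun s => C * s + g s) t = C + deriv g t := by
    have h1 := (hgc.differentiable (by norm_num) t).hasDerivAt
    have h2 := ((hasDerivAt_id t).const_mul C).add h1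
    simpa using! h2.deriv
  rw [hd] at hfin
  linarith [hgd t ht0, hG x (gradient (fun y => c * ‖y - x₀‖ ^ 2) x)]

/-! ### The perturbed doubling of variables -/

theorem exists_perturbed_max {N : ℕ} {Q : Set ((Euc N × ℝ) × (Euc N × ℝ))} (hQ : IsCompact Q)
    {F D : (Euc N × ℝ) × (Euc N × ℝ) → ℝ} (hF : ContinuousOn F Q) (hD : Continuous D)
    (hD0 : ∀ ξ, 0 ≤ D ξ) {v : Euc N → ℝ} (hvc : Continuous v) (hvp : IsZPeriodic v) {V : ℝ}
    (hV : ∀ z, |v z| ≤ V) {ε : ℝ} (hε : 0 < ε) {ξ₀ : (Euc N × ℝ) × (Euc N × ℝ)} (h₀ : ξ₀ ∈ Q)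
    (hmax : ∀ ξ ∈ Q, F ξ ≤ F ξ₀) :
    ∃ ξ ∈ Q, ∃ z, (∀ ξ' ∈ Q, ∀ z',
        F ξ' - D ξ' - ε * v z' - ε⁻¹ * perPen (ε⁻¹ • ξ'.1.1 - z') ≤
          F ξ - D ξ - ε * v z - ε⁻¹ * perPen (ε⁻¹ • ξ.1.1 - z)) ∧
      D ξ ≤ D ξ₀ + 2 * (ε * V) ∧ F ξ₀ - D ξ₀ - 2 * (ε * V) ≤ F ξ ∧
      perPen (ε⁻¹ • ξ.1.1 - z) ≤ ε * (2 * (ε * V)) := by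
  set B := Metric.closedBall (0 : Euc N) (Real.sqrt N)
  have hB : IsCompact B := isCompact_closedBall _ _
  have hpc : Continuous (perPen (N := N)) := perPen_contDiff.continuous
  have hcont : ContinuousOn (fun q : ((Euc N × ℝ) × (Euc N × ℝ)) × Euc N =>
      F q.1 - D q.1 - ε * v q.2 - ε⁻¹ * perPen (ε⁻¹ • q.1.1.1 - q.2)) (Q ×ˢ B) := by
    refine ContinuousOn.sub (ContinuousOn.sub (ContinuousOn.sub ?_ ?_) ?_) ?_
    · exact hF.comp continuousOn_fst fun q hq => hq.1
    all_goals fun_prop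
  obtain ⟨⟨ξ, z⟩, ⟨hξ, -⟩, hm⟩ := (hQ.prod hB).exists_isMaxOn ⟨(ξ₀, 0), h₀, by simp [B]⟩ hcont
  have key : ∀ ξ' ∈ Q, ∀ z',
        F ξ' - D ξ' - ε * v z' - ε⁻¹ * perPen (ε⁻¹ • ξ'.1.1 - z') ≤
          F ξ - D ξ - ε * v z - ε⁻¹ * perPen (ε⁻¹ • ξ.1.1 - z) := by
    intro ξ' hξ' z'
    obtain ⟨n, hn⟩ := exists_add_intVec_mem_closedBall z'
    have := hm (show (ξ', z' + intVec n) ∈ Q ×ˢ B from ⟨hξ', hn⟩)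
    have e : ε⁻¹ • ξ'.1.1 - (z' + intVec n) = ε⁻¹ • ξ'.1.1 - z' - intVec n := by module
    simpa only [mem_ofPred_eq, e, perPen_periodic.sub_intVec, hvp _ n] using this
  have hvb : ∀ z, |ε * v z| ≤ ε * V := fun z => by
    rw [abs_mul, abs_of_pos hε]; exact mul_le_mul_of_nonneg_left (hV z) hε.le
  have hS : 0 ≤ ε⁻¹ * perPen (ε⁻¹ • ξ.1.1 - z) :=
    mul_nonneg (inv_nonneg.2 hε.le) (perPen_nonneg _)
  have h1 := key ξ₀ h₀ (ε⁻¹ • ξ₀.1.1)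
  have h2 := key ξ hξ (ε⁻¹ • ξ.1.1)
  simp only [sub_self, perPen_zero, mul_zero, sub_zero] at h1 h2
  have b1 := abs_le.1 (hvb (ε⁻¹ • ξ₀.1.1))
  have b2 := abs_le.1 (hvb (ε⁻¹ • ξ.1.1))
  have b3 := abs_le.1 (hvb z)
  refine ⟨ξ, hξ, z, key, by linarith [hmax ξ hξ], by linarith [hD0 ξ], ?_⟩
  have h3 : ε⁻¹ * perPen (ε⁻¹ • ξ.1.1 - z) ≤ 2 * (ε * V) := by linarith
  rwa [inv_mul_le_iff₀ hε] at h3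

theorem deriv_quadratic_add {c d s b : ℝ} {g : ℝ → ℝ} {t : ℝ} (hg : DifferentiableAt ℝ g t) :
    deriv (fun r => c * (r - s) ^ 2 + d * (r - b) ^ 2 + g r) t =
      2 * c * (t - s) + 2 * d * (t - b) + deriv g t := by
  have h1 : ∀ a : ℝ, HasDerivAt (fun r => (r - a) ^ 2) (2 * (t - a)) t := fun a => by
    simpa using! ((hasDerivAt_id t).sub_const a).pow 2
  have h := (((h1 s).const_mul c).add ((h1 b).const_mul d)).add hg.hasDerivAt
  refine Eq.trans h.deriv ?_
  ring

theorem doubling_inequality {N : ℕ} {G : Euc N → Euc N → ℝ} {Gbar : Euc N → ℝ} {L : ℝ}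
    (hLip : ∀ x p q, |G x p - G x q| ≤ L * ‖p - q‖)
    (hbar : ∀ p q, |Gbar p - Gbar q| ≤ L * ‖p - q‖) (hL : 0 ≤ L)
    {P : Euc N} {v : Euc N → ℝ} (hv : IsCellSupersolution G P (Gbar P) v)
    {T τ R ε e c α : ℝ} (hε : 0 < ε) (hτ : τ < T) (hα : 0 ≤ α)
    {w u : Euc N → ℝ → ℝ} (hw : IsParaSub (fun x p => G (ε⁻¹ • x) p) T w)
    (hu : IsParaSuper (fun _ p => Gbar p) T u) {g : ℝ → ℝ} (hg : ContDiff ℝ 1 g)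
    {x y z x' y' : Euc N} {t s t' s' : ℝ} (hx : ‖x‖ < R) (hy : ‖y‖ < R)
    (ht0 : 0 < t) (htτ : t < τ) (hs0 : 0 < s) (hsτ : s < τ)
    (he : ∀ p, |G (ε⁻¹ • x) p - G z p| ≤ e)
    (hmax : ∀ a r b q d, ‖a‖ ≤ R → 0 ≤ r → r ≤ τ → ‖b‖ ≤ R → 0 ≤ q → q ≤ τ →
      (w a r - u b q - c * ‖a - b‖ ^ 2 - c * (r - q) ^ 2 - α * ‖a‖ ^ 2 - g r - g q) -
        (‖a - x'‖ ^ 2 + (r - t') ^ 2 + ‖b - y'‖ ^ 2 + (q - s') ^ 2) - ε * v d -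
          ε⁻¹ * perPen (ε⁻¹ • a - d) ≤
      (w x t - u y s - c * ‖x - y‖ ^ 2 - c * (t - s) ^ 2 - α * ‖x‖ ^ 2 - g t - g s) -
        (‖x - x'‖ ^ 2 + (t - t') ^ 2 + ‖y - y'‖ ^ 2 + (s - s') ^ 2) - ε * v z -
          ε⁻¹ * perPen (ε⁻¹ • x - z)) :
    deriv g t + deriv g s ≤ e + L * (2 * α * ‖x‖ + 2 * ‖x - x'‖ + ‖(2 * c) • (x - y) - P‖) +
      L * (‖(2 * c) • (x - y) - P‖ + 2 * ‖y - y'‖) + 2 * |t - t'| + 2 * |s - s'| := by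
  have hgd := hg.differentiable (by norm_num)
  set q : Euc N := (ε⁻¹ * ε⁻¹) • gradient perPen (ε⁻¹ • x - z) with hq
  set A : Euc N → ℝ := fun a => c * ‖a - y‖ ^ 2 + α * ‖a - 0‖ ^ 2 + 1 * ‖a - x'‖ ^ 2 +
    ε⁻¹ * perPen (ε⁻¹ • a - z) with hA
  have hsq : ∀ b : Euc N, ContDiff ℝ 1 fun a : Euc N => ‖a - b‖ ^ 2 := fun b =>
    (contDiff_id.sub contDiff_const).norm_sq ℝ
  have hAc : ContDiff ℝ 1 A := by
    have h1 := hsq y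
    have h2 := hsq 0
    have h3 := hsq x'
    have h4 : ContDiff ℝ 1 fun a : Euc N => perPen (ε⁻¹ • a - z) :=
      perPen_contDiff.comp ((contDiff_id.const_smul ε⁻¹).sub contDiff_const)
    fun_prop
  have hAg : gradient A x = (2 * c) • (x - y) + (2 * α) • x + (2 : ℝ) • (x - x') + q := by
    have h := ((((HasGradientAt.norm_sub_sq y x).fun_const_mul c).fun_add
      ((HasGradientAt.norm_sub_sq 0 x).fun_const_mul α)).fun_add
      ((HasGradientAt.norm_sub_sq x' x).fun_const_mul 1)).fun_add
      (hasGradientAt_perPen_left ε⁻¹ ε⁻¹ x z)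
    refine h.gradient.trans ?_
    rw [hq]
    module
  have ew := hw A (fun r => c * (r - s) ^ 2 + 1 * (r - t') ^ 2 + g r) hAc (by fun_prop) x t ht0
    (htτ.trans hτ) (isLocParaMax_of_forall_le (c := 0) (R := R) (by simpa using hx) htτ
      fun a r ha hr hr' => by
        have := hmax a r y s z (by simpa using ha) hr hr' hy.le hs0.le hsτ.le
        simp only [hA, sub_zero]
        linarith)
  rw [deriv_quadratic_add (hgd t), hAg] at ew
  have hqmem : q ∈ subDiff v z := gradient_perPen_mem_subDiff fun d => by
    have h1 := hmax x t y s d hx.le ht0.le htτ.le hy.le hs0.le hsτ.le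
    have h2 : ε * (v z + ε⁻¹ * ε⁻¹ * perPen (ε⁻¹ • x - z)) ≤
        ε * (v d + ε⁻¹ * ε⁻¹ * perPen (ε⁻¹ • x - d)) := by
      have h3 : ∀ k m : ℝ, ε * (k + ε⁻¹ * ε⁻¹ * m) = ε * k + ε⁻¹ * m := fun k m => by field_simp
      rw [h3, h3]
      linarith
    exact le_of_mul_le_mul_left h2 hε
  have ev := hv z q hqmem
  set A' : Euc N → ℝ := fun b => (-c) * ‖b - x‖ ^ 2 + (-1) * ‖b - y'‖ ^ 2 with hA'
  have hAc' : ContDiff ℝ 1 A' := by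
    have h1 := hsq x
    have h2 := hsq y'
    fun_prop
  have hAg' : gradient A' y = (2 * c) • (x - y) - (2 : ℝ) • (y - y') := by
    have h := ((HasGradientAt.norm_sub_sq x y).fun_const_mul (-c)).fun_add
      ((HasGradientAt.norm_sub_sq y' y).fun_const_mul (-1))
    refine h.gradient.trans ?_
    module
  have eu := hu A' (fun r => (-c) * (r - t) ^ 2 + (-1) * (r - s') ^ 2 + -g r) hAc' (by fun_prop)
    y s hs0 (hsτ.trans hτ) (isLocParaMin_of_forall_le (c := 0) (R := R) (by simpa using hy) hsτ
      fun b r hb hr hr' => by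
        have := hmax x t b r z hx.le ht0.le htτ.le (by simpa using hb) hr hr'
        rw [norm_sub_rev x b, norm_sub_rev x y] at this
        simp only [hA']
        linarith)
  rw [deriv_quadratic_add (g := fun r => -g r) (hgd s).neg, hAg', deriv.fun_neg] at eu
  have e1 := abs_le.1 (he ((2 * c) • (x - y) + (2 * α) • x + (2 : ℝ) • (x - x') + q))
  have e2 := abs_le.1 (hLip z ((2 * c) • (x - y) + (2 * α) • x + (2 : ℝ) • (x - x') + q) (q + P))
  have e3 := abs_le.1 (hbar P ((2 * c) • (x - y) - (2 : ℝ) • (y - y')))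
  have n1 : ‖(2 * c) • (x - y) + (2 * α) • x + (2 : ℝ) • (x - x') + q - (q + P)‖ ≤
      2 * α * ‖x‖ + 2 * ‖x - x'‖ + ‖(2 * c) • (x - y) - P‖ := by
    have : (2 * c) • (x - y) + (2 * α) • x + (2 : ℝ) • (x - x') + q - (q + P) =
      (2 * α) • x + (2 : ℝ) • (x - x') + ((2 * c) • (x - y) - P) := by module
    rw [this]
    refine (norm_add₃_le).trans_eq ?_
    rw [norm_smul, norm_smul, Real.norm_of_nonneg (by positivity), Real.norm_two]
  have n2 : ‖P - ((2 * c) • (x - y) - (2 : ℝ) • (y - y'))‖ ≤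
      ‖(2 * c) • (x - y) - P‖ + 2 * ‖y - y'‖ := by
    have : P - ((2 * c) • (x - y) - (2 : ℝ) • (y - y')) =
      -((2 * c) • (x - y) - P) + (2 : ℝ) • (y - y') := by module
    rw [this]
    refine (norm_add_le _ _).trans_eq ?_
    rw [norm_neg, norm_smul, Real.norm_two]
  have m1 := mul_le_mul_of_nonneg_left n1 hL
  have m2 := mul_le_mul_of_nonneg_left n2 hL
  linarith [neg_abs_le (t - t'), neg_abs_le (s - s')]

/-- The doubled functional at `((x, t), (y, s))`. -/
def doublingFun {N : ℕ} (w u : Euc N → ℝ → ℝ) (c α : ℝ) (g : ℝ → ℝ)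
    (ξ : (Euc N × ℝ) × (Euc N × ℝ)) : ℝ :=
  w ξ.1.1 ξ.1.2 - u ξ.2.1 ξ.2.2 - c * ‖ξ.1.1 - ξ.2.1‖ ^ 2 - c * (ξ.1.2 - ξ.2.2) ^ 2 -
    α * ‖ξ.1.1‖ ^ 2 - g ξ.1.2 - g ξ.2.2

/-- The compact set on which the doubled functional is maximized. -/
def doublingSet (N : ℕ) (R τ : ℝ) : Set ((Euc N × ℝ) × (Euc N × ℝ)) :=
  (Metric.closedBall 0 R ×ˢ Icc 0 τ) ×ˢ (Metric.closedBall 0 R ×ˢ Icc 0 τ)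

theorem mem_doublingSet {N : ℕ} {R τ : ℝ} {ξ : (Euc N × ℝ) × (Euc N × ℝ)} :
    ξ ∈ doublingSet N R τ ↔
      (‖ξ.1.1‖ ≤ R ∧ 0 ≤ ξ.1.2 ∧ ξ.1.2 ≤ τ) ∧ ‖ξ.2.1‖ ≤ R ∧ 0 ≤ ξ.2.2 ∧ ξ.2.2 ≤ τ := by
  simp [doublingSet, mem_prod]

theorem isCompact_doublingSet (N : ℕ) (R τ : ℝ) : IsCompact (doublingSet N R τ) :=
  have h := (isCompact_closedBall (0 : Euc N) R).prod (isCompact_Icc (a := (0 : ℝ)) (b := τ))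
  h.prod h

theorem continuousOn_doublingFun {N : ℕ} {w u : Euc N → ℝ → ℝ} {c α R τ T : ℝ} {g : ℝ → ℝ}
    (hτ : τ < T)
    (hw : ContinuousOn (fun q : Euc N × ℝ => w q.1 q.2) {q | 0 ≤ q.2 ∧ q.2 < T})
    (hu : ContinuousOn (fun q : Euc N × ℝ => u q.1 q.2) {q | 0 ≤ q.2 ∧ q.2 < T})
    (hg : Continuous g) : ContinuousOn (doublingFun w u c α g) (doublingSet N R τ) := by
  have h1 : ContinuousOn (fun ξ : (Euc N × ℝ) × (Euc N × ℝ) => w ξ.1.1 ξ.1.2)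
      (doublingSet N R τ) := hw.comp continuousOn_fst fun ξ hξ =>
    ⟨(mem_doublingSet.1 hξ).1.2.1, (mem_doublingSet.1 hξ).1.2.2.trans_lt hτ⟩
  have h2 : ContinuousOn (fun ξ : (Euc N × ℝ) × (Euc N × ℝ) => u ξ.2.1 ξ.2.2)
      (doublingSet N R τ) := hu.comp continuousOn_snd fun ξ hξ =>
    ⟨(mem_doublingSet.1 hξ).2.2.1, (mem_doublingSet.1 hξ).2.2.2.trans_lt hτ⟩
  unfold doublingFun
  refine ContinuousOn.sub (ContinuousOn.sub (ContinuousOn.sub (ContinuousOn.sub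
    (ContinuousOn.sub (h1.sub h2) ?_) ?_) ?_) ?_) ?_
  all_goals fun_prop

/-- Points with a large value of the doubled functional are interior. -/
theorem interior_of_lt_doublingFun {N : ℕ} {w u : Euc N → ℝ → ℝ} {c α R₁ R₂ τ a B K C : ℝ}
    {g : ℝ → ℝ} (ha : 0 < a) (hc : 0 < c) (hα : 0 < α) (hR₁ : 0 ≤ R₁) (hR₂ : 0 ≤ R₂)
    (hg0 : ∀ t, 0 ≤ g t) (hgB : B ≤ g τ) (hαR : B ≤ α * R₁ ^ 2) (hcR : B ≤ c * R₂ ^ 2)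
    (hKc : K ^ 2 ≤ 4 * c * (a / 2)) (hCc : C ^ 2 ≤ 4 * c * (a / 2))
    (hB : ∀ x t y s, 0 ≤ t → t ≤ τ → 0 ≤ s → s ≤ τ → w x t - u y s ≤ B)
    (hinit : ∀ x t y s, 0 ≤ t → t ≤ τ → 0 ≤ s → s ≤ τ → (t = 0 ∨ s = 0) →
      w x t - u y s ≤ K * ‖x - y‖ + C * |t - s|)
    {x y : Euc N} {t s : ℝ} (hξ : ((x, t), (y, s)) ∈ doublingSet N (R₁ + R₂) τ)
    (hF : a < doublingFun w u c α g ((x, t), (y, s))) :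
    ‖x‖ < R₁ + R₂ ∧ ‖y‖ < R₁ + R₂ ∧ 0 < t ∧ t < τ ∧ 0 < s ∧ s < τ ∧ α * ‖x‖ ^ 2 ≤ B := by
  obtain ⟨⟨-, ht0, htτ⟩, -, hs0, hsτ⟩ := mem_doublingSet.1 hξ
  simp only at ht0 htτ hs0 hsτ
  simp only [doublingFun] at hF
  have hb := hB x t y s ht0 htτ hs0 hsτ
  have p1 : 0 ≤ c * ‖x - y‖ ^ 2 := by positivity
  have p2 : 0 ≤ c * (t - s) ^ 2 := by positivity
  have p3 : 0 ≤ α * ‖x‖ ^ 2 := by positivity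
  have g1 := hg0 t
  have g2 := hg0 s
  have hx : ‖x‖ < R₁ := by
    by_contra! h
    have : α * R₁ ^ 2 ≤ α * ‖x‖ ^ 2 := by gcongr
    linarith
  have hxy : ‖x - y‖ < R₂ := by
    by_contra! h
    have : c * R₂ ^ 2 ≤ c * ‖x - y‖ ^ 2 := by gcongr
    linarith
  have hpos : ¬ (t = 0 ∨ s = 0) := fun h => by
    have h1 := hinit x t y s ht0 htτ hs0 hsτ h
    have h2 := mul_sub_mul_sq_le (r := ‖x - y‖) hc hKc
    have h3 := mul_sub_mul_sq_le (r := |t - s|) hc hCc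
    rw [sq_abs] at h3
    linarith
  push Not at hpos
  refine ⟨by linarith, ?_, ht0.lt_of_ne' hpos.1, htτ.lt_of_ne fun h => ?_, hs0.lt_of_ne' hpos.2,
    hsτ.lt_of_ne fun h => ?_, by linarith⟩
  · have := norm_sub_norm_le y x
    rw [norm_sub_rev] at this
    linarith
  · rw [← h] at hgB
    linarith
  · rw [← h] at hgB
    linarith

theorem exists_bound_of_isCompact {N : ℕ} {K : Set (Euc N × ℝ)} (hK : IsCompact K)
    (hne : K.Nonempty) {T : ℝ} (hKT : ∀ q ∈ K, 0 ≤ q.2 ∧ q.2 < T) :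
    ∃ T' R, 0 ≤ T' ∧ T' < T ∧ 0 ≤ R ∧ ∀ x t, (x, t) ∈ K → t ≤ T' ∧ ‖x‖ ≤ R := by
  obtain ⟨q, hq, hmax⟩ := hK.exists_isMaxOn hne (f := fun q : Euc N × ℝ => q.2)
    (Continuous.continuousOn (by fun_prop))
  obtain ⟨r, -, hmax'⟩ := hK.exists_isMaxOn hne (f := fun q : Euc N × ℝ => ‖q.1‖)
    (Continuous.continuousOn (by fun_prop))
  exact ⟨q.2, ‖r.1‖, (hKT q hq).1, (hKT q hq).2, norm_nonneg _, fun x t h =>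
    ⟨isMaxOn_iff.1 hmax (x, t) h, isMaxOn_iff.1 hmax' (x, t) h⟩⟩

theorem exists_doubling_parameters {a μ B r : ℝ} (L K C : ℝ) (ha : 0 < a) (hμ : 0 < μ)
    (hB : 1 ≤ B) (hr : 0 ≤ r) :
    ∃ α c R₁ R₂, 0 < α ∧ 0 < c ∧ 0 ≤ R₂ ∧ r ≤ R₁ ∧ α * r ^ 2 ≤ a ∧ α * (4 * L ^ 2 * B) ≤ μ ^ 2 ∧
      B ≤ α * R₁ ^ 2 ∧ B ≤ c * R₂ ^ 2 ∧ K ^ 2 ≤ 4 * c * (a / 2) ∧ C ^ 2 ≤ 4 * c * (a / 2) := by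
  obtain ⟨α, hα0, hα1, hα2⟩ : ∃ α, 0 < α ∧ α * (r ^ 2 + 1) ≤ a ∧
      α * (4 * L ^ 2 * B + 1) ≤ μ ^ 2 := by
    refine ⟨min (a / (r ^ 2 + 1)) (μ ^ 2 / (4 * L ^ 2 * B + 1)), by positivity, ?_, ?_⟩
    · rw [← le_div_iff₀ (by positivity)]
      exact min_le_left _ _
    · rw [← le_div_iff₀ (by positivity)]
      exact min_le_right _ _
  have hd : 0 ≤ (K ^ 2 + C ^ 2) / (2 * a) := by positivity
  have hca : 4 * ((K ^ 2 + C ^ 2) / (2 * a) + 1) * (a / 2) = K ^ 2 + C ^ 2 + 2 * a := by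
    field_simp
    ring
  have hBα : 0 ≤ B / α := by positivity
  refine ⟨α, (K ^ 2 + C ^ 2) / (2 * a) + 1, r + B / α + 1, B, hα0, by linarith, by linarith,
    by linarith, by linarith, by linarith, ?_, by nlinarith, by nlinarith, by nlinarith⟩
  have h1 : B ≤ α * (r + B / α + 1) := by
    rw [mul_comm, ← div_le_iff₀ hα0]
    linarith
  nlinarith

theorem exists_small_radius {L c a μ : ℝ} (hL : 0 ≤ L) (hc : 0 ≤ c) (ha : 0 < a) (hμ : 0 < μ) :
    ∃ ρ > 0, ρ ^ 2 ≤ a ∧ ρ * (4 * L + 8 * c * L + 4) ≤ μ / 2 := by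
  refine ⟨min (min a 1) (μ / 2 / (4 * L + 8 * c * L + 4)), by positivity, ?_, ?_⟩
  · have h0 : 0 < min (min a 1) (μ / 2 / (4 * L + 8 * c * L + 4)) := by positivity
    have h1 := (min_le_left (min a 1) (μ / 2 / (4 * L + 8 * c * L + 4))).trans (min_le_left _ _)
    have h2 := (min_le_left (min a 1) (μ / 2 / (4 * L + 8 * c * L + 4))).trans (min_le_right _ _)
    nlinarith
  · rw [← le_div_iff₀ (by positivity)]
    exact min_le_right _ _

theorem not_doubling_inequality {N : ℕ} {L c α μ ρ B γ₁ γ₂ : ℝ} (hL : 0 ≤ L) (hc : 0 ≤ c)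
    (hα : 0 ≤ α) (hμ : 0 < μ) (hρ : 0 ≤ ρ) (hρμ : ρ * (4 * L + 8 * c * L + 4) ≤ μ / 2)
    (hαμ : α * (4 * L ^ 2 * B) ≤ μ ^ 2) {x y x' y' : Euc N} {t s t' s' : ℝ}
    (hx : α * ‖x‖ ^ 2 ≤ B)
    (hd : ‖x - x'‖ ^ 2 + (t - t') ^ 2 + ‖y - y'‖ ^ 2 + (s - s') ^ 2 ≤ ρ ^ 2)
    (hγ₁ : μ ≤ γ₁) (hγ₂ : μ ≤ γ₂)
    (h : γ₁ + γ₂ ≤ μ / 4 + L * (2 * α * ‖x‖ + 2 * ‖x - x'‖ +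
        ‖(2 * c) • (x - y) - (2 * c) • (x' - y')‖) +
      L * (‖(2 * c) • (x - y) - (2 * c) • (x' - y')‖ + 2 * ‖y - y'‖) + 2 * |t - t'| +
        2 * |s - s'|) : False := by
  have p1 := sq_nonneg ‖x - x'‖
  have p2 := sq_nonneg (t - t')
  have p3 := sq_nonneg ‖y - y'‖
  have p4 := sq_nonneg (s - s')
  have hxx : ‖x - x'‖ ≤ ρ := (abs_le_of_sq_le_sq' (by linarith) hρ).2
  have hyy : ‖y - y'‖ ≤ ρ := (abs_le_of_sq_le_sq' (by linarith) hρ).2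
  have htt : |t - t'| ≤ ρ := abs_le_of_sq_le_sq (by linarith) hρ
  have hss : |s - s'| ≤ ρ := abs_le_of_sq_le_sq (by linarith) hρ
  have hP : ‖(2 * c) • (x - y) - (2 * c) • (x' - y')‖ ≤ 2 * c * (ρ + ρ) := by
    have : (2 * c) • (x - y) - (2 * c) • (x' - y') = (2 * c) • ((x - x') - (y - y')) := by module
    rw [this, norm_smul, Real.norm_of_nonneg (by positivity)]
    gcongr
    exact (norm_sub_le _ _).trans (add_le_add hxx hyy)
  have hLα : L * (2 * α * ‖x‖) ≤ μ := by
    refine (abs_le_of_sq_le_sq' ?_ hμ.le).2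
    have h1 : 4 * L ^ 2 * α * (α * ‖x‖ ^ 2) ≤ 4 * L ^ 2 * α * B := by gcongr
    linarith
  have k1 := mul_le_mul_of_nonneg_left hxx hL
  have k2 := mul_le_mul_of_nonneg_left hyy hL
  have k3 := mul_le_mul_of_nonneg_left hP hL
  linarith

set_option maxHeartbeats 400000 in
/-- One-sided homogenization estimate, uniform on compact sets: subsolutions of the oscillating
equation lie asymptotically below supersolutions of the effective equation. -/
theorem homogenization_limsup_le {N : ℕ} {G : Euc N → Euc N → ℝ} {Gbar : Euc N → ℝ} {L C : ℝ}
    (hLip : ∀ x p q, |G x p - G x q| ≤ L * ‖p - q‖) (hmod : IsPerUnifContH G)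
    (hGC : ∀ x p, |G x p| ≤ C) (hbar : ∀ p q, |Gbar p - Gbar q| ≤ L * ‖p - q‖)
    (hbarC : ∀ p, |Gbar p| ≤ C) (hL : 0 ≤ L)
    (hcell : ∀ P, ∃ v, Continuous v ∧ IsZPeriodic v ∧ IsCellSupersolution G P (Gbar P) v)
    {T : ℝ} {u₀ : Euc N → ℝ} {K₀ M₀ : ℝ} (hu₀ : ∀ x y, |u₀ x - u₀ y| ≤ K₀ * ‖x - y‖)
    (hM₀ : ∀ x, |u₀ x| ≤ M₀) {w : ℝ → Euc N → ℝ → ℝ}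
    (hw0 : ∀ ε, 0 < ε → ∀ x, w ε x 0 = u₀ x)
    (hwc : ∀ ε, 0 < ε →
      ContinuousOn (fun q : Euc N × ℝ => w ε q.1 q.2) {q | 0 ≤ q.2 ∧ q.2 < T})
    (hwb : ∀ ε, 0 < ε → ∃ M, ∀ x t, 0 ≤ t → t < T → |w ε x t| ≤ M)
    (hw : ∀ ε, 0 < ε → IsParaSub (fun x p => G (ε⁻¹ • x) p) T (w ε)) {u : Euc N → ℝ → ℝ}
    (hu0 : ∀ x, u x 0 = u₀ x)
    (huc : ContinuousOn (fun q : Euc N × ℝ => u q.1 q.2) {q | 0 ≤ q.2 ∧ q.2 < T})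
    (hub : ∃ M, ∀ x t, 0 ≤ t → t < T → |u x t| ≤ M)
    (hu : IsParaSuper (fun _ p => Gbar p) T u) {K : Set (Euc N × ℝ)} (hK : IsCompact K)
    (hKT : ∀ q ∈ K, 0 ≤ q.2 ∧ q.2 < T) {δ : ℝ} (hδ : 0 < δ) :
    ∃ ε₀ > 0, ∀ ε, 0 < ε → ε < ε₀ → ∀ q ∈ K, w ε q.1 q.2 - u q.1 q.2 ≤ δ := by
  by_contra! hneg
  have hC : 0 ≤ C := (abs_nonneg _).trans (hbarC 0)
  have hM : 0 ≤ M₀ := (abs_nonneg _).trans (hM₀ 0)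
  have hwup : ∀ ε, 0 < ε → ∀ x t, 0 ≤ t → t < T → w ε x t ≤ u₀ x + C * t := by
    intro ε hε x t h0 h1
    obtain ⟨M, hMb⟩ := hwb ε hε
    rw [← hw0 ε hε x]
    exact (hw ε hε).le_add_mul (K := K₀) (M := M) hC (fun y p => (abs_le.1 (hGC _ p)).1) (hwc ε hε)
      (fun y s hs hs' => (abs_le.1 (hMb y s hs hs')).2)
      (fun y z => by rw [hw0 ε hε, hw0 ε hε]; exact (abs_le.1 (hu₀ y z)).2) x t h0 h1
  have hulow : ∀ x t, 0 ≤ t → t < T → u₀ x - C * t ≤ u x t := by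
    intro x t h0 h1
    obtain ⟨M, hMb⟩ := hub
    have := hu.neg.le_add_mul (K := K₀) (M := M) hC
      (fun y p => by linarith [(abs_le.1 (hbarC (-p))).2]) huc.neg
      (fun y s hs hs' => by linarith [(abs_le.1 (hMb y s hs hs')).1])
      (fun y z => by rw [hu0, hu0]; linarith [(abs_le.1 (hu₀ y z)).1]) x t h0 h1
    simp only [hu0] at this
    linarith
  obtain ⟨-, -, -, q₀, hq₀, -⟩ := hneg 1 one_pos
  obtain ⟨T', RK, hT'0, hT'T, hRK0, hKTR⟩ := exists_bound_of_isCompact hK ⟨q₀, hq₀⟩ hKT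
  obtain ⟨τ, hτ⟩ : ∃ r, r = (T' + T) / 2 := ⟨_, rfl⟩
  have hτT : τ < T := by linarith
  have hT'τ : T' < τ := by linarith
  have hT0 : 0 < T := by linarith
  obtain ⟨a, ha⟩ : ∃ r, r = δ / 8 := ⟨_, rfl⟩
  have ha0 : 0 < a := by rw [ha]; positivity
  obtain ⟨B, hB⟩ : ∃ r, r = 2 * (M₀ + C * T) + 1 := ⟨_, rfl⟩
  have hCT : 0 ≤ C * T := by positivity
  have hB1 : 1 ≤ B := by linarith
  obtain ⟨g, μ, hμ, hgc, hg0, hga, hgB, hgd⟩ := exists_time_barrier ha0 hT'τ B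
  obtain ⟨α, c, R₁, R₂, hα0, hc0, hR₂, hRR, hα1, hα2, hαR, hcR, hKc, hCc⟩ :=
    exists_doubling_parameters L K₀ C ha0 hμ hB1 hRK0
  set Q := doublingSet N (R₁ + R₂) τ with hQ
  have hQc : IsCompact Q := isCompact_doublingSet _ _ _
  have hBd : ∀ ε, 0 < ε → ∀ x t y s, 0 ≤ t → t ≤ τ → 0 ≤ s → s ≤ τ → w ε x t - u y s ≤ B := by
    intro ε hε x t y s h1 h2 h3 h4
    have e1 := hwup ε hε x t h1 (by linarith)
    have e2 := hulow y s h3 (by linarith)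
    have e3 : C * t ≤ C * T := by gcongr; linarith
    have e4 : C * s ≤ C * T := by gcongr; linarith
    linarith [(abs_le.1 (hM₀ x)).2, (abs_le.1 (hM₀ y)).1]
  have hinit : ∀ ε, 0 < ε → ∀ x t y s, 0 ≤ t → t ≤ τ → 0 ≤ s → s ≤ τ → (t = 0 ∨ s = 0) →
      w ε x t - u y s ≤ K₀ * ‖x - y‖ + C * |t - s| := by
    intro ε hε x t y s h1 h2 h3 h4 h5
    have e1 := hwup ε hε x t h1 (by linarith)
    have e2 := hulow y s h3 (by linarith)
    have e3 : C * |t - s| = C * t + C * s := by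
      rcases h5 with rfl | rfl
      · simp [abs_of_nonneg h3]
      · simp [abs_of_nonneg h1]
    linarith [(abs_le.1 (hu₀ x y)).2]
  have hseq : ∀ n : ℕ, ∃ ε : ℝ, 0 < ε ∧ ε < 1 / ((n : ℝ) + 1) ∧ ∃ ξ ∈ Q,
      (∀ ξ' ∈ Q, doublingFun (w ε) u c α g ξ' ≤ doublingFun (w ε) u c α g ξ) ∧
        5 * a ≤ doublingFun (w ε) u c α g ξ := by
    intro n
    obtain ⟨ε, hε, hεn, ⟨x, t⟩, hqK, hq⟩ := hneg (1 / ((n : ℝ) + 1)) (by positivity)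
    have hx : ‖x‖ ≤ RK := (hKTR x t hqK).2
    have ht : t ≤ T' := (hKTR x t hqK).1
    have ht0 : 0 ≤ t := (hKT (x, t) hqK).1
    have hmem : ((x, t), (x, t)) ∈ Q := by
      have : ‖x‖ ≤ R₁ + R₂ := by linarith
      exact mem_doublingSet.2 ⟨⟨this, ht0, ht.trans hT'τ.le⟩, this, ht0, ht.trans hT'τ.le⟩
    obtain ⟨ξ, hξ, hmax⟩ := hQc.exists_isMaxOn ⟨_, hmem⟩
      (continuousOn_doublingFun (c := c) (α := α) (g := g) hτT (hwc ε hε) huc hgc.continuous)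
    refine ⟨ε, hε, hεn, ξ, hξ, fun ξ' h => hmax h, le_trans ?_ (hmax hmem)⟩
    have hα3 : α * ‖x‖ ^ 2 ≤ α * RK ^ 2 := by gcongr
    simp only [doublingFun, sub_self, norm_zero, ne_eq, OfNat.ofNat_ne_zero, not_false_eq_true,
      zero_pow, mul_zero, sub_zero]
    linarith [hga t ht]
  choose εs hεpos hεlt ξs hξQ hξmax hξval using hseq
  obtain ⟨⟨⟨x', t'⟩, ⟨y', s'⟩⟩, -, φ, hφ, hlim⟩ := hQc.tendsto_subseq hξQ
  set P := (2 * c) • (x' - y') with hP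
  obtain ⟨v, hvc, hvp, hv⟩ := hcell P
  obtain ⟨V, hV0, hV⟩ := hvp.exists_abs_le hvc
  obtain ⟨d, hd, hmodd⟩ := hmod (μ / 4) (by positivity)
  obtain ⟨ρ, hρ0, hρsq, hρμ⟩ := exists_small_radius hL hc0.le ha0 hμ
  set D : (Euc N × ℝ) × (Euc N × ℝ) → ℝ := fun ξ =>
    ‖ξ.1.1 - x'‖ ^ 2 + (ξ.1.2 - t') ^ 2 + ‖ξ.2.1 - y'‖ ^ 2 + (ξ.2.2 - s') ^ 2 with hD
  have hDc : Continuous D := by fun_prop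
  have hD0 : ∀ ξ, 0 ≤ D ξ := fun ξ => by positivity
  have hεlim : Tendsto (fun n => εs (φ n)) atTop (nhds 0) :=
    (squeeze_zero (fun n => (hεpos n).le) (fun n => (hεlt n).le)
      tendsto_one_div_add_atTop_nhds_zero_nat).comp hφ.tendsto_atTop
  have hDlim : Tendsto (fun n => D (ξs (φ n))) atTop (nhds 0) := by
    have := (hDc.tendsto ((x', t'), (y', s'))).comp hlim
    simpa [hD] using! this
  have hVlim : Tendsto (fun n => 2 * (εs (φ n) * V)) atTop (nhds 0) := by
    simpa using (hεlim.mul_const V).const_mul 2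
  have hpenlim : Tendsto (fun n => εs (φ n) * (2 * (εs (φ n) * V))) atTop (nhds 0) := by
    simpa using hεlim.mul hVlim
  have hρ2 : 0 < ρ ^ 2 / 2 := by positivity
  obtain ⟨n, hn1, hn2, hn3⟩ := ((hDlim.eventually_le_const hρ2).and
    ((hVlim.eventually_le_const hρ2).and (hpenlim.eventually_le_const hd))).exists
  have hε := hεpos (φ n)
  set ε := εs (φ n) with hεdef
  obtain ⟨⟨⟨x, t⟩, ⟨y, s⟩⟩, hξ, z, hmax, hDξ, hFξ, hpen⟩ := exists_perturbed_max hQc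
    (continuousOn_doublingFun (c := c) (α := α) (g := g) hτT (hwc ε hε) huc hgc.continuous)
    hDc hD0 hvc hvp hV hε (hξQ (φ n)) (hξmax (φ n))
  obtain ⟨hx, hy, ht0, htτ, hs0, hsτ, hαx⟩ := interior_of_lt_doublingFun ha0 hc0 hα0
    (by linarith) (by linarith) hg0 hgB hαR hcR hKc hCc (hBd ε hε) (hinit ε hε) hξ
    (by linarith [hξval (φ n)])
  have hineq := doubling_inequality hLip hbar hL hv hε hτT hα0.le (hw ε hε) hu hgc hx hy
    ht0 htτ hs0 hsτ (fun p => hmodd (ε⁻¹ • x) z p (hpen.trans hn3))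
    fun a' r b q d' h1 h2 h3 h4 h5 h6 =>
      hmax ((a', r), (b, q)) (mem_doublingSet.2 ⟨⟨h1, h2, h3⟩, h4, h5, h6⟩) d'
  have hDρ : ‖x - x'‖ ^ 2 + (t - t') ^ 2 + ‖y - y'‖ ^ 2 + (s - s') ^ 2 ≤ ρ ^ 2 := by
    simp only [hD] at hDξ hn1
    linarith
  exact not_doubling_inequality hL hc0.le hα0.le hμ hρ0.le hρμ hα2 hαx hDρ (hgd t ht0.le)
    (hgd s hs0.le) hineq

/-! ### Two-sided estimate -/

theorem homogenization_abs_sub_le {N : ℕ} {G : Euc N → Euc N → ℝ} {Gbar : Euc N → ℝ} {L C : ℝ}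
    (hLip : ∀ x p q, |G x p - G x q| ≤ L * ‖p - q‖) (hmod : IsPerUnifContH G)
    (hGC : ∀ x p, |G x p| ≤ C) (hL : 0 ≤ L)
    (hcell : ∀ P, ∃ v, IsCellSolution G P v (Gbar P))
    {T : ℝ} {u₀ : Euc N → ℝ} {K₀ M₀ : ℝ} (hu₀ : ∀ x y, |u₀ x - u₀ y| ≤ K₀ * ‖x - y‖)
    (hM₀ : ∀ x, |u₀ x| ≤ M₀) {w : ℝ → Euc N → ℝ → ℝ}
    (hw : ∀ ε, 0 < ε → IsParabolicSolution (fun x p => G (ε⁻¹ • x) p) u₀ T (w ε))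
    {u : Euc N → ℝ → ℝ} (hu : IsParabolicSolution (fun _ p => Gbar p) u₀ T u)
    {K : Set (Euc N × ℝ)} (hK : IsCompact K) (hKT : ∀ q ∈ K, 0 ≤ q.2 ∧ q.2 < T)
    {δ : ℝ} (hδ : 0 < δ) :
    ∃ ε₀ > 0, ∀ ε, 0 < ε → ε < ε₀ → ∀ q ∈ K, |w ε q.1 q.2 - u q.1 q.2| ≤ δ := by
  have hbar : ∀ p q, |Gbar p - Gbar q| ≤ L * ‖p - q‖ := by
    have h : ∀ p q, Gbar q ≤ Gbar p + L * ‖p - q‖ := fun p q => by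
      obtain ⟨v, ⟨_, hvK⟩, hvp, hv, -⟩ := hcell p
      obtain ⟨v', ⟨_, hvK'⟩, hvp', -, hv'⟩ := hcell q
      exact cell_comparison hLip hmod hvK.continuous hvK'.continuous hvp hvp' hv hv'
    intro p q
    have h1 := h q p
    rw [norm_sub_rev] at h1
    exact abs_le.2 ⟨by linarith [h p q], by linarith⟩
  have hbarC : ∀ p, |Gbar p| ≤ C := fun p => (hcell p).choose_spec.abs_le hGC
  obtain ⟨ε₁, hε₁, h₁⟩ := homogenization_limsup_le hLip hmod hGC hbar hbarC hL
    (fun P => by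
      obtain ⟨v, ⟨_, hvK⟩, hvp, -, hv⟩ := hcell P
      exact ⟨v, hvK.continuous, hvp, hv⟩)
    hu₀ hM₀ (fun ε hε => (hw ε hε).1) (fun ε hε => (hw ε hε).2.1) (fun ε hε => (hw ε hε).2.2.1)
    (fun ε hε => (hw ε hε).isParaSub) hu.1 hu.2.1 hu.2.2.1 hu.isParaSuper hK hKT hδ
  obtain ⟨ε₂, hε₂, h₂⟩ := homogenization_limsup_le (G := fun x p => -G x (-p))
    (Gbar := fun p => -Gbar (-p)) (L := L) (C := C) (u₀ := fun x => -u₀ x) (K₀ := K₀) (M₀ := M₀)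
    (w := fun ε x t => -w ε x t) (u := fun x t => -u x t) (T := T)
    (fun x p q => by
      have := hLip x (-q) (-p)
      rwa [neg_sub_neg] at this ⊢)
    (fun e he => by
      obtain ⟨d, hd, H⟩ := hmod e he
      refine ⟨d, hd, fun x z p h => ?_⟩
      rw [neg_sub_neg, abs_sub_comm]
      exact H x z _ h)
    (fun x p => by simpa using hGC x (-p))
    (fun p q => by
      have := hbar (-q) (-p)
      rwa [neg_sub_neg] at this ⊢)
    (fun p => by simpa using hbarC (-p)) hL
    (fun P => by
      obtain ⟨v, ⟨_, hvK⟩, hvp, hv, -⟩ := hcell (-P)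
      have := hv.neg
      rw [neg_neg] at this
      exact ⟨_, hvK.continuous.neg, hvp.neg, this⟩)
    (fun x y => by
      rw [neg_sub_neg, abs_sub_comm]
      exact hu₀ x y)
    (fun x => by simpa using hM₀ x) (fun ε hε x => congrArg Neg.neg ((hw ε hε).1 x))
    (fun ε hε => (hw ε hε).2.1.neg)
    (fun ε hε => by simpa using (hw ε hε).2.2.1)
    (fun ε hε => (hw ε hε).isParaSuper.neg) (fun x => congrArg Neg.neg (hu.1 x)) hu.2.1.neg
    (by simpa using hu.2.2.1) hu.isParaSub.neg hK hKT hδ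
  refine ⟨min ε₁ ε₂, lt_min hε₁ hε₂, fun ε hε hlt q hq => abs_le.2 ⟨?_, ?_⟩⟩
  · linarith [h₂ ε hε (hlt.trans_le (min_le_right _ _)) q hq]
  · exact h₁ ε hε (hlt.trans_le (min_le_left _ _)) q hq

/-- Homogenization under full solvability of the cell problem. -/
theorem homogenization_full_solvability {N : ℕ} (hN : 1 ≤ N)
    (σ : Euc N → ℝ) (m : ℝ → ℝ)
    (hσc : Continuous σ) (hσp : IsZPeriodic σ) (hσpos : ∀ x, 0 < σ x)
    (hm01 : ∀ r : ℝ, 0 ≤ r → 0 < m r ∧ m r < 1)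
    (hmLip : ∃ L : NNReal, LipschitzOnWith L m (Set.Ici 0))
    (hmmono : StrictMonoOn m (Set.Ici 0))
    (hmlim : Tendsto m atTop (nhds 1))
    -- full solvability: D = ℝ^N
    (hD : ∀ P : Euc N, ∃ (u : Euc N → ℝ) (a : ℝ),
        IsCellSolution (fun x p => σ x * m ‖p‖) P u a)
    -- H̄ is the critical value of the cell problem
    (Hbar : Euc N → ℝ)
    (hHbar : ∀ (P : Euc N) (u : Euc N → ℝ) (a : ℝ),
        IsCellSolution (fun x p => σ x * m ‖p‖) P u a → Hbar P = a)
    (T : ℝ) (hT : 0 < T)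
    (u₀ : Euc N → ℝ) (hu₀b : ∃ M : ℝ, ∀ x, |u₀ x| ≤ M)
    (hu₀lip : ∃ K : NNReal, LipschitzWith K u₀)
    (uε : ℝ → Euc N → ℝ → ℝ)
    (huε : ∀ ε : ℝ, 0 < ε →
        IsParabolicSolution (fun x p => σ (ε⁻¹ • x) * m ‖p‖) u₀ T (uε ε))
    (u : Euc N → ℝ → ℝ)
    (hu : IsParabolicSolution (fun _ p => Hbar p) u₀ T u) :
    ∀ K : Set (Euc N × ℝ), IsCompact K → (∀ q ∈ K, 0 ≤ q.2 ∧ q.2 < T) →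
      ∀ δ > (0:ℝ), ∃ ε₀ > (0:ℝ), ∀ ε : ℝ, 0 < ε → ε < ε₀ →
        ∀ q ∈ K, |uε ε q.1 q.2 - u q.1 q.2| ≤ δ := by
  obtain ⟨C, hC0, hC⟩ := hσp.exists_abs_le hσc
  obtain ⟨Lm, hLm⟩ := hmLip
  obtain ⟨M₀, hM₀⟩ := hu₀b
  obtain ⟨K₀, hK₀⟩ := hu₀lip
  intro K hK hKT δ hδ
  refine homogenization_abs_sub_le (G := fun x p => σ x * m ‖p‖) (L := C * Lm) (C := C) (K₀ := K₀)
    (fun x p q => ?_) (fun e he => ?_) (fun x p => ?_) (by positivity) (fun P => ?_)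
    (fun x y => ?_) hM₀ huε hu hK hKT hδ
  · rw [← mul_sub, abs_mul, mul_assoc]
    have h1 : |m ‖p‖ - m ‖q‖| ≤ Lm * |‖p‖ - ‖q‖| := by
      simpa [Real.dist_eq] using hLm.dist_le_mul ‖p‖ (norm_nonneg p) ‖q‖ (norm_nonneg q)
    have h2 : |m ‖p‖ - m ‖q‖| ≤ Lm * ‖p - q‖ := h1.trans (by gcongr; exact abs_norm_sub_norm_le p q)
    exact mul_le_mul (hC x) h2 (abs_nonneg _) hC0
  · obtain ⟨d, hd, H⟩ := hσp.exists_perPen_modulus hσc he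
    refine ⟨d, hd, fun x z p h => ?_⟩
    obtain ⟨h0, h1⟩ := hm01 ‖p‖ (norm_nonneg p)
    rw [← sub_mul, abs_mul, abs_of_pos h0]
    exact (mul_le_of_le_one_right (abs_nonneg _) h1.le).trans (H x z h)
  · obtain ⟨h0, h1⟩ := hm01 ‖p‖ (norm_nonneg p)
    rw [abs_mul, abs_of_pos h0]
    exact (mul_le_of_le_one_right (abs_nonneg _) h1.le).trans (hC x)
  · obtain ⟨v, a, hv⟩ := hD P
    exact ⟨v, (hHbar P v a hv).symm ▸ hv⟩
  · simpa [Real.dist_eq, dist_eq_norm] using hK₀.dist_le_mul x y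
end
end

section
/- Regularity of solutions of the oscillating problem: Let T > 0 and u₀ : ℝ^N → ℝ be bounded and Lipschitz continuous with Lipschitz constant Lip[u₀], and assume m(Lip[u₀]) < σ̲/σ̄. For each ε > 0, every bounded viscosity solution u^ε of u_t + σ(x/ε) m(|Du|) = 0 in ℝ^N × (0,T) with u^ε(·,0) = u₀ satisfies |u^ε(x,t) − u^ε(x,s)| ≤ C|t − s| and |u^ε(x,t) − u^ε(y,t)| ≤ K|x − y| for all x, y ∈ ℝ^N and t, s ∈ [0,T), where C = σ̄ m(Lip[u₀]) and K = m⁻¹((σ̄/σ̲) m(Lip[u₀])). -/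
open Set Filter MeasureTheory

noncomputable section

section Viscosity

variable {N : ℕ}

/-- A smooth approximation of `‖x - y‖`. -/
def cone (ρ : ℝ) (y x : Euc N) : ℝ := √(ρ ^ 2 + ‖x - y‖ ^ 2)

lemma norm_le_cone (ρ : ℝ) (y x : Euc N) : ‖x - y‖ ≤ cone ρ y x :=
  Real.le_sqrt_of_sq_le (by nlinarith [sq_nonneg ρ])

lemma cone_le {ρ : ℝ} (hρ : 0 ≤ ρ) (y x : Euc N) : cone ρ y x ≤ ρ + ‖x - y‖ :=
  Real.sqrt_le_iff.2 ⟨by positivity, by nlinarith [norm_nonneg (x - y)]⟩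

lemma le_cone (ρ : ℝ) (y x : Euc N) : ρ ≤ cone ρ y x :=
  Real.le_sqrt_of_sq_le (by nlinarith [sq_nonneg ‖x - y‖])

lemma cone_pos {ρ : ℝ} (hρ : 0 < ρ) (y x : Euc N) : 0 < cone ρ y x :=
  hρ.trans_le (le_cone ρ y x)

lemma contDiff_cone {ρ : ℝ} (hρ : 0 < ρ) (y : Euc N) : ContDiff ℝ 1 (cone ρ y) := by
  unfold cone
  exact (contDiff_const.add ((contDiff_id.sub contDiff_const).norm_sq ℝ)).sqrt
    fun x => by simp only [id]; positivity

lemma hasGradientAt_norm_sub_sq (y x : Euc N) :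
    HasGradientAt (fun z => ‖z - y‖ ^ 2) ((2 : ℝ) • (x - y)) x := by
  rw [hasGradientAt_iff_hasFDerivAt]
  refine (((hasFDerivAt_id x).sub_const y).norm_sq).congr_fderiv ?_
  ext z
  simp

lemma hasGradientAt_cone {ρ : ℝ} (hρ : 0 < ρ) (y x : Euc N) :
    HasGradientAt (cone ρ y) ((cone ρ y x)⁻¹ • (x - y)) x := by
  rw [hasGradientAt_iff_hasFDerivAt]
  have h := (hasGradientAt_norm_sub_sq y x).hasFDerivAt
  refine ((h.const_add (ρ ^ 2)).sqrt (by positivity)).congr_fderiv ?_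
  ext z
  simp only [smul_apply, InnerProductSpace.toDual_apply_apply,
    inner_smul_left, smul_eq_mul, cone]
  simp
  ring

lemma norm_gradient_cone_le {ρ : ℝ} (hρ : 0 < ρ) (y x : Euc N) :
    ‖(cone ρ y x)⁻¹ • (x - y)‖ ≤ 1 := by
  have h := cone_pos hρ y x
  rw [norm_smul, norm_inv, Real.norm_of_nonneg h.le, inv_mul_le_one₀ h]
  exact norm_le_cone ρ y x

/-- A test function in time which is large at the time `b` and small at an earlier time `a`. -/
lemma exists_terminal_penalty {a b R e : ℝ} (ha : 0 ≤ a) (hab : a < b) (hR : 0 ≤ R) (he : 0 < e) :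
    ∃ (ψ : ℝ → ℝ) (η : ℝ), 0 < η ∧ ContDiff ℝ 1 ψ ∧ (∀ t, η ≤ deriv ψ t) ∧
      (∀ t, 0 ≤ t → 0 ≤ ψ t) ∧ R ≤ ψ b ∧ ψ a < e := by
  have hlim : Tendsto (fun n : ℕ => R * Real.exp (a - b) ^ n) atTop (nhds (R * 0)) :=
    (tendsto_pow_atTop_nhds_zero_of_lt_one (Real.exp_pos _).le
      (by rw [← Real.exp_zero]; exact Real.exp_lt_exp.2 (by linarith))).const_mul R
  obtain ⟨n, hn⟩ := (hlim.eventually_lt_const (u := e / 2) (by linarith)).exists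
  have hη : 0 < e / (2 * (a + 1)) := by positivity
  have hder : ∀ t, HasDerivAt (fun t : ℝ => e / (2 * (a + 1)) * t + R * Real.exp (n * (t - b)))
      (e / (2 * (a + 1)) * 1 + R * (Real.exp (n * (t - b)) * (n * 1))) t := fun t =>
    ((hasDerivAt_id t).const_mul _).add
      (((((hasDerivAt_id t).sub_const b).const_mul (n : ℝ)).exp).const_mul R)
  refine ⟨fun t => e / (2 * (a + 1)) * t + R * Real.exp (n * (t - b)), e / (2 * (a + 1)), hη,
    by fun_prop, fun t => ?_, fun t ht => by positivity, ?_, ?_⟩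
  · rw [(hder t).deriv]
    have : 0 ≤ R * (Real.exp (n * (t - b)) * (n * 1)) := by positivity
    linarith
  · have : 0 ≤ e / (2 * (a + 1)) * b := mul_nonneg hη.le (by linarith)
    simpa using this
  · rw [← Real.exp_nat_mul] at hn
    have : e / (2 * (a + 1)) * a < e / 2 := by
      rw [div_mul_eq_mul_div, div_lt_div_iff₀ (by positivity) (by norm_num)]
      nlinarith
    simp only
    linarith

lemma exists_isMaxOn_of_bounded {E : Type*} [PseudoMetricSpace E] [ProperSpace E] {S : Set E}
    (hS : IsClosed S) {f : E → ℝ} (hf : ContinuousOn f S) {p : E} (hp : p ∈ S) (r : ℝ)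
    (hr : ∀ q ∈ S, f p ≤ f q → dist q p ≤ r) : ∃ q ∈ S, IsMaxOn f S q := by
  refine hf.exists_isMaxOn' hS hp ?_
  rw [eventually_inf_principal]
  have := (isCompact_closedBall p r).compl_mem_cocompact
  filter_upwards [this] with q hq hqS
  by_contra! h
  exact hq (Metric.mem_closedBall.2 (hr q hqS h.le))

/-- Subsolutions of `w_t + G(x, Dw) = 0` on `(0, T)`, tested with separated test functions. -/
def IsSubsolution (G : Euc N → Euc N → ℝ) (T : ℝ) (w : Euc N → ℝ → ℝ) : Prop :=
  ∀ (a : Euc N → ℝ) (g : ℝ → ℝ), ContDiff ℝ 1 a → ContDiff ℝ 1 g →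
    ∀ (x₀ : Euc N) (t₀ : ℝ), 0 < t₀ → t₀ < T →
      IsLocParaMax T w (fun x t => a x + g t) x₀ t₀ →
      deriv g t₀ + G x₀ (gradient a x₀) ≤ 0

lemma IsSubsolution.of_isMax {G : Euc N → Euc N → ℝ} {T T' : ℝ} {w : Euc N → ℝ → ℝ}
    (hw : IsSubsolution G T w) (hT' : T' ≤ T) {a : Euc N → ℝ} {g : ℝ → ℝ} (ha : ContDiff ℝ 1 a)
    (hg : ContDiff ℝ 1 g) {x₀ : Euc N} {t₀ : ℝ} (h0 : 0 < t₀) (h1 : t₀ < T')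
    (hmax : ∀ y s, s ∈ Icc 0 T' → w y s - (a y + g s) ≤ w x₀ t₀ - (a x₀ + g t₀)) :
    deriv g t₀ + G x₀ (gradient a x₀) ≤ 0 := by
  refine hw a g ha hg x₀ t₀ h0 (h1.trans_le hT') ⟨T' - t₀, by linarith, fun y s _ hs hs0 _ => ?_⟩
  exact hmax y s ⟨hs0.le, by linarith [(abs_lt.1 hs).2]⟩

lemma IsSubsolution.shift {G : Euc N → Euc N → ℝ} {T : ℝ} {w : Euc N → ℝ → ℝ}
    (hw : IsSubsolution G T w) {h : ℝ} (hh : 0 ≤ h) :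
    IsSubsolution G (T - h) (fun x t => w x (t + h)) := by
  rintro a g ha hg x₀ t₀ h0 h1 ⟨δ, hδ, hmax⟩
  have := hw a (fun t => g (t - h)) ha (by fun_prop) x₀ (t₀ + h) (by linarith) (by linarith)
    ⟨min δ t₀, lt_min hδ h0, fun y s hy hs hs0 hsT => by
      have h2 : |s - h - t₀| < min δ t₀ := by rwa [sub_sub, add_comm h]
      have h3 := h2.trans_le (min_le_right _ _)
      have := hmax y (s - h) (hy.trans_le (min_le_left _ _)) (h2.trans_le (min_le_left _ _))
        (by linarith [(abs_lt.1 h3).1]) (by linarith)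
      simpa using this⟩
  rwa [deriv_comp_sub_const, add_sub_cancel_right] at this

lemma IsParabolicSolution.isSubsolution {G : Euc N → Euc N → ℝ} {u₀ : Euc N → ℝ} {T : ℝ}
    {w : Euc N → ℝ → ℝ} (hw : IsParabolicSolution G u₀ T w) : IsSubsolution G T w := by
  intro a g ha hg x₀ t₀ h0 h1 hmax
  have := hw.2.2.2.1 (fun x t => a x + g t) (by fun_prop) x₀ t₀ h0 h1 hmax
  rw [deriv_const_add] at this
  have hgr : gradient (fun y => a y + g t₀) x₀ = gradient a x₀ := by
    simp only [gradient, fderiv_add_const]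
  rwa [hgr] at this

lemma IsParabolicSolution.isSubsolution_neg {G : Euc N → Euc N → ℝ} {u₀ : Euc N → ℝ} {T : ℝ}
    {w : Euc N → ℝ → ℝ} (hw : IsParabolicSolution G u₀ T w) :
    IsSubsolution (fun x p => -G x (-p)) T (fun x t => -w x t) := by
  rintro a g ha hg x₀ t₀ h0 h1 ⟨δ, hδ, hmax⟩
  have := hw.2.2.2.2 (fun x t => -a x + -g t) (by fun_prop) x₀ t₀ h0 h1
    ⟨δ, hδ, fun y s h2 h3 h4 h5 => by linarith [hmax y s h2 h3 h4 h5]⟩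
  rw [deriv_const_add, deriv.fun_neg] at this
  have hgr : gradient (fun y => -a y + -g t₀) x₀ = -gradient a x₀ := by
    simp only [gradient, fderiv_add_const, fderiv_fun_neg, map_neg]
  rw [hgr] at this
  linarith

lemma IsSubsolution.le_of_le_cone {G : Euc N → Euc N → ℝ} {T M : ℝ} {w : Euc N → ℝ → ℝ}
    (hw : IsSubsolution G T w)
    (hwc : ContinuousOn (fun q : Euc N × ℝ => w q.1 q.2) {q | 0 ≤ q.2 ∧ q.2 < T})
    (hM : ∀ x t, 0 ≤ t → t < T → |w x t| ≤ M) {L b c : ℝ} {y : Euc N} (hL : 0 < L)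
    (hG : ∀ x p, ‖p‖ ≤ L → 0 ≤ c + G x p) (h0 : ∀ x, w x 0 ≤ b + L * ‖x - y‖)
    {t : ℝ} (ht0 : 0 ≤ t) (htT : t < T) : w y t ≤ b + c * t := by
  by_contra! hgap
  obtain ⟨γ, hγ, hγe⟩ : ∃ γ, 0 < γ ∧ w y t = b + c * t + 2 * γ :=
    ⟨(w y t - (b + c * t)) / 2, by linarith, by ring⟩
  obtain ⟨T', htT', hT'T⟩ := exists_between htT
  have hT' : 0 < T' := ht0.trans_lt htT'
  have hM0 : 0 ≤ M := (abs_nonneg _).trans (hM y t ht0 htT)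
  have hT0 : 0 ≤ T := ht0.trans htT.le
  obtain ⟨ψ, η, hη, hψ, hψ', hψ0, hψR, hψt⟩ := exists_terminal_penalty (R := M + |b| + |c| * T)
    ht0 htT' (by positivity) hγ
  obtain ⟨ρ, hρ, hρL⟩ : ∃ ρ, 0 < ρ ∧ L * ρ = γ := ⟨γ / L, by positivity, by field_simp⟩
  have hbound : ∀ x s, s ∈ Icc 0 T' → w x s - b - c * s ≤ M + |b| + |c| * T := by
    intro x s hs
    have h1 := (abs_le.1 (hM x s hs.1 (hs.2.trans_lt hT'T))).2
    have h2 : -(c * s) ≤ |c| * T := by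
      rw [← neg_mul]
      exact mul_le_mul (neg_le_abs c) (hs.2.trans hT'T.le) hs.1 (abs_nonneg c)
    linarith [neg_le_abs b]
  have hcone : ∀ x, 0 ≤ L * cone ρ y x := fun x => (mul_pos hL (cone_pos hρ y x)).le
  have hconey : cone ρ y y = ρ := by simp [cone, Real.sqrt_sq hρ.le]
  set Φ : Euc N × ℝ → ℝ := fun q => w q.1 q.2 - (L * cone ρ y q.1 + (b + c * q.2 + ψ q.2)) with hΦ
  have hpos : 0 < Φ (y, t) := by
    simp only [hΦ, hconey, hρL, hγe]
    linarith
  have hcont : ContinuousOn Φ (univ ×ˢ Icc 0 T') := by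
    refine (hwc.mono fun q hq => ⟨hq.2.1, hq.2.2.trans_lt hT'T⟩).sub (Continuous.continuousOn ?_)
    have h1 := (contDiff_cone hρ y).continuous
    have h2 := hψ.continuous
    fun_prop
  obtain ⟨⟨x₀, s₀⟩, hmem, hmax⟩ := exists_isMaxOn_of_bounded (isClosed_univ.prod isClosed_Icc) hcont
    (p := (y, t)) ⟨mem_univ _, ht0, htT'.le⟩ (max ((M + |b| + |c| * T) / L) T') (by
      rintro ⟨x, s⟩ ⟨-, hs⟩ hle
      refine max_le_max ?_ ?_
      · rw [dist_eq_norm, le_div_iff₀ hL]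
        have h1 : 0 < w x s - (L * cone ρ y x + (b + c * s + ψ s)) := hpos.trans_le hle
        have h2 := mul_le_mul_of_nonneg_left (norm_le_cone ρ y x) hL.le
        linarith [hbound x s hs, hψ0 s hs.1]
      · exact (Real.dist_le_of_mem_Icc hs ⟨ht0, htT'.le⟩).trans (by simp))
  have hs : s₀ ∈ Icc 0 T' := hmem.2
  have hposm : 0 < w x₀ s₀ - (L * cone ρ y x₀ + (b + c * s₀ + ψ s₀)) :=
    hpos.trans_le (hmax ⟨mem_univ _, ht0, htT'.le⟩)
  rcases hs.1.eq_or_lt with h | h1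
  · subst h
    have h2 := mul_le_mul_of_nonneg_left (norm_le_cone ρ y x₀) hL.le
    linarith [h0 x₀, hψ0 0 le_rfl]
  rcases hs.2.eq_or_lt with h | h2
  · subst h
    linarith [hbound x₀ s₀ hs, hcone x₀]
  have hder : HasDerivAt (fun s => b + c * s + ψ s) (c * 1 + deriv ψ s₀) s₀ :=
    (((hasDerivAt_id s₀).const_mul c).const_add b).add
      (hψ.differentiable (by simp) s₀).hasDerivAt
  have hgrad : HasGradientAt (fun x => L * cone ρ y x) (L • ((cone ρ y x₀)⁻¹ • (x₀ - y))) x₀ := by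
    rw [hasGradientAt_iff_hasFDerivAt, map_smul]
    exact (hasGradientAt_cone hρ y x₀).hasFDerivAt.const_mul L
  have key := hw.of_isMax hT'T.le (a := fun x => L * cone ρ y x)
    (g := fun s => b + c * s + ψ s) (contDiff_const.mul (contDiff_cone hρ y)) (by fun_prop) h1 h2
    fun x s hs => hmax (show (x, s) ∈ univ ×ˢ Icc 0 T' from ⟨mem_univ _, hs⟩)
  rw [hder.deriv, hgrad.gradient] at key
  have hn : ‖L • ((cone ρ y x₀)⁻¹ • (x₀ - y))‖ ≤ L := by
    rw [norm_smul, Real.norm_of_nonneg hL.le]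
    exact mul_le_of_le_one_right hL.le (norm_gradient_cone_le hρ y x₀)
  linarith [hG x₀ _ hn, hψ' s₀]

/-- Comparison of a subsolution `u` with a supersolution `-v`. -/
lemma IsSubsolution.add_le {G : Euc N → Euc N → ℝ}
    (hG : UniformContinuous fun z : Euc N × Euc N => G z.1 z.2) {T M A L : ℝ}
    {u v : Euc N → ℝ → ℝ} (hu : IsSubsolution G T u)
    (hv : IsSubsolution (fun x p => -G x (-p)) T v)
    (huc : ContinuousOn (fun q : Euc N × ℝ => u q.1 q.2) {q | 0 ≤ q.2 ∧ q.2 < T})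
    (hvc : ContinuousOn (fun q : Euc N × ℝ => v q.1 q.2) {q | 0 ≤ q.2 ∧ q.2 < T})
    (huM : ∀ x t, 0 ≤ t → t < T → |u x t| ≤ M) (hvM : ∀ x t, 0 ≤ t → t < T → |v x t| ≤ M)
    (hL : 0 ≤ L)
    (h0 : ∀ x y t s, 0 ≤ t → t < T → 0 ≤ s → s < T → (t = 0 ∨ s = 0) →
      u x t + v y s ≤ A + L * (‖x - y‖ + |t - s|))
    {x : Euc N} {t : ℝ} (ht0 : 0 ≤ t) (htT : t < T) : u x t + v x t ≤ A := by
  by_contra! hgap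
  obtain ⟨γ, hγ, hγe⟩ : ∃ γ, 0 < γ ∧ u x t + v x t = A + 5 * γ :=
    ⟨(u x t + v x t - A) / 5, by linarith, by ring⟩
  obtain ⟨T', htT', hT'T⟩ := exists_between htT
  have hT' : 0 < T' := ht0.trans_lt htT'
  have hM0 : 0 ≤ M := (abs_nonneg _).trans (huM x t ht0 htT)
  obtain ⟨B, hB, hBA, hBM⟩ : ∃ B, 0 < B ∧ -A ≤ B - 2 * M ∧ 2 * M ≤ B :=
    ⟨2 * M + |A| + 1, by positivity, by linarith [neg_le_abs A], by linarith [abs_nonneg A]⟩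
  obtain ⟨ψ, η, hη, hψ, hψ', hψ0, hψR, hψt⟩ := exists_terminal_penalty (R := B) ht0 htT' hB.le hγ
  obtain ⟨d, hd, hGd⟩ := Metric.uniformContinuous_iff.1 hG η hη
  have hcx := cone_pos one_pos 0 x
  obtain ⟨β, hβ, hβd, hβx⟩ : ∃ β, 0 < β ∧ β < d ∧ β * cone 1 0 x ≤ γ := by
    refine ⟨min (d / 2) (γ / cone 1 0 x), by positivity, by linarith [min_le_left (d / 2) (γ /
      cone 1 0 x)], ?_⟩
    rw [← le_div_iff₀ hcx]
    exact min_le_right _ _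
  obtain ⟨r, hr, hrd, hrL⟩ : ∃ r, 0 < r ∧ r ≤ d ∧ L * (r + r) ≤ γ := by
    refine ⟨min d (γ / (2 * L + 1)), by positivity, min_le_left _ _, ?_⟩
    have := min_le_right d (γ / (2 * L + 1))
    rw [le_div_iff₀ (by positivity)] at this
    have : 0 < min d (γ / (2 * L + 1)) := by positivity
    linarith
  obtain ⟨k, hk, hkr⟩ : ∃ k, 0 < k ∧ B < k * r ^ 2 := by
    refine ⟨(B + 1) / r ^ 2, by positivity, ?_⟩
    rw [div_mul_cancel₀ _ (by positivity)]
    linarith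
  have hsq : ∀ z, 0 ≤ z → k * z ^ 2 ≤ B → z < r := by
    intro z hz hzB
    by_contra! h
    have : k * r ^ 2 ≤ k * z ^ 2 := by gcongr
    linarith
  have hbound : ∀ x y s s', s ∈ Icc 0 T' → s' ∈ Icc 0 T' → u x s + v y s' ≤ 2 * M := by
    intro x y s s' hs hs'
    linarith [(abs_le.1 (huM x s hs.1 (hs.2.trans_lt hT'T))).2,
      (abs_le.1 (hvM y s' hs'.1 (hs'.2.trans_lt hT'T))).2]
  have hcone : ∀ x : Euc N, 0 ≤ β * cone 1 0 x := fun x => (mul_pos hβ (cone_pos one_pos 0 x)).le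
  set Φ : (Euc N × ℝ) × (Euc N × ℝ) → ℝ := fun q => u q.1.1 q.1.2 + v q.2.1 q.2.2 -
    (k * ‖q.1.1 - q.2.1‖ ^ 2 + k * (q.1.2 - q.2.2) ^ 2 + β * cone 1 0 q.1.1 + ψ q.1.2 + ψ q.2.2)
    with hΦ
  have hpos : A + γ < Φ ((x, t), (x, t)) := by
    simp only [hΦ, hγe, sub_self, norm_zero]
    linarith
  have hmem0 : ((x, t), (x, t)) ∈ (univ ×ˢ Icc 0 T') ×ˢ (univ ×ˢ Icc 0 T' : Set (Euc N × ℝ)) :=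
    ⟨⟨mem_univ _, ht0, htT'.le⟩, mem_univ _, ht0, htT'.le⟩
  have hcont : ContinuousOn Φ ((univ ×ˢ Icc 0 T') ×ˢ (univ ×ˢ Icc 0 T')) := by
    refine ((huc.comp continuousOn_fst fun q hq => ⟨hq.1.2.1, hq.1.2.2.trans_lt hT'T⟩).add
      (hvc.comp continuousOn_snd fun q hq => ⟨hq.2.2.1, hq.2.2.2.trans_lt hT'T⟩)).sub
      (Continuous.continuousOn ?_)
    have h1 := (contDiff_cone one_pos (0 : Euc N)).continuous
    have h2 := hψ.continuous
    fun_prop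
  have hlarge : ∀ y z s s', s ∈ Icc 0 T' → s' ∈ Icc 0 T' → A + γ < Φ ((y, s), (z, s')) →
      k * ‖y - z‖ ^ 2 + k * |s - s'| ^ 2 + β * cone 1 0 y ≤ B := by
    intro y z s s' hs hs' hlt
    simp only [hΦ] at hlt
    rw [sq_abs]
    linarith [hbound y z s s' hs hs', hψ0 s hs.1, hψ0 s' hs'.1]
  obtain ⟨⟨⟨y, s⟩, ⟨z, s'⟩⟩, ⟨⟨-, hs⟩, ⟨-, hs'⟩⟩, hmax⟩ := exists_isMaxOn_of_bounded
    ((isClosed_univ.prod isClosed_Icc).prod (isClosed_univ.prod isClosed_Icc)) hcont hmem0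
    (max (max (B / β + ‖x‖) T') (max (r + B / β + ‖x‖) T')) (by
      rintro ⟨⟨y, s⟩, ⟨z, s'⟩⟩ ⟨⟨-, hs⟩, ⟨-, hs'⟩⟩ hle
      have hl := hlarge y z s s' hs hs' (hpos.trans_le hle)
      have hyz : ‖y - z‖ < r := hsq _ (norm_nonneg _) <| by
        have : 0 ≤ k * |s - s'| ^ 2 := by positivity
        linarith [hcone y]
      have hy : ‖y‖ ≤ B / β := by
        have h1 : 0 ≤ k * |s - s'| ^ 2 := by positivity
        have h2 : 0 ≤ k * ‖y - z‖ ^ 2 := by positivity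
        have h3 := mul_le_mul_of_nonneg_left (norm_le_cone 1 0 y) hβ.le
        rw [sub_zero] at h3
        rw [le_div_iff₀ hβ]
        linarith
      have hz : ‖z‖ ≤ ‖y - z‖ + ‖y‖ := by
        simpa [norm_sub_rev] using norm_add_le (z - y) y
      refine max_le_max (max_le_max ?_ ?_) (max_le_max ?_ ?_)
      · rw [dist_eq_norm]
        linarith [norm_sub_le y x]
      · exact (Real.dist_le_of_mem_Icc hs ⟨ht0, htT'.le⟩).trans (by simp)
      · rw [dist_eq_norm]
        linarith [norm_sub_le z x]
      · exact (Real.dist_le_of_mem_Icc hs' ⟨ht0, htT'.le⟩).trans (by simp))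
  have hposm : A + γ < Φ ((y, s), (z, s')) := hpos.trans_le (hmax hmem0)
  have hl := hlarge y z s s' hs hs' hposm
  have hk1 : 0 ≤ k * |s - s'| ^ 2 := by positivity
  have hk2 : 0 ≤ k * ‖y - z‖ ^ 2 := by positivity
  have hyz : ‖y - z‖ < r := hsq _ (norm_nonneg _) (by linarith [hcone y])
  have hss : |s - s'| < r := hsq _ (abs_nonneg _) (by linarith [hcone y])
  have hposm' : A + γ + (ψ s + ψ s') < u y s + v z s' := by
    simp only [hΦ] at hposm
    rw [← sq_abs (s - s')] at hposm
    linarith [hcone y]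
  by_cases hzero : s = 0 ∨ s' = 0
  · have h1 := h0 y z s s' hs.1 (hs.2.trans_lt hT'T) hs'.1 (hs'.2.trans_lt hT'T) hzero
    have h2 : L * (‖y - z‖ + |s - s'|) ≤ L * (r + r) := by gcongr
    linarith [hψ0 s hs.1, hψ0 s' hs'.1]
  by_cases hterm : s = T' ∨ s' = T'
  · have h1 : B ≤ ψ s + ψ s' := by
      rcases hterm with rfl | rfl
      · linarith [hψ0 s' hs'.1]
      · linarith [hψ0 s hs.1]
    linarith [hbound y z s s' hs hs']
  push Not at hzero hterm
  have hdu : HasDerivAt (fun τ => k * (τ - s') ^ 2 + ψ τ)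
      (k * ((2 : ℕ) * (s - s') ^ (2 - 1) * 1) + deriv ψ s) s :=
    ((((hasDerivAt_id s).sub_const s').pow 2).const_mul k).add
      (hψ.differentiable (by simp) s).hasDerivAt
  have hdv : HasDerivAt (fun τ => k * (τ - s) ^ 2 + ψ τ)
      (k * ((2 : ℕ) * (s' - s) ^ (2 - 1) * 1) + deriv ψ s') s' :=
    ((((hasDerivAt_id s').sub_const s).pow 2).const_mul k).add
      (hψ.differentiable (by simp) s').hasDerivAt
  have hgu : HasGradientAt (fun ξ => k * ‖ξ - z‖ ^ 2 + β * cone 1 0 ξ)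
      (k • ((2 : ℝ) • (y - z)) + β • ((cone 1 0 y)⁻¹ • (y - 0))) y := by
    rw [hasGradientAt_iff_hasFDerivAt, map_add, map_smul _ k, map_smul _ β]
    exact ((hasGradientAt_norm_sub_sq z y).hasFDerivAt.const_mul k).add
      ((hasGradientAt_cone one_pos 0 y).hasFDerivAt.const_mul β)
  have hgv : HasGradientAt (fun ξ => k * ‖ξ - y‖ ^ 2) (k • ((2 : ℝ) • (z - y))) z := by
    rw [hasGradientAt_iff_hasFDerivAt, map_smul _ k]
    exact (hasGradientAt_norm_sub_sq y z).hasFDerivAt.const_mul k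
  have hsqd : ∀ ζ : Euc N, ContDiff ℝ 1 fun ξ => k * ‖ξ - ζ‖ ^ 2 := fun ζ =>
    contDiff_const.mul ((contDiff_id.sub contDiff_const).norm_sq ℝ)
  have hku := hu.of_isMax hT'T.le (x₀ := y) (t₀ := s)
    (a := fun ξ => k * ‖ξ - z‖ ^ 2 + β * cone 1 0 ξ)
    ((hsqd z).add (contDiff_const.mul (contDiff_cone one_pos 0)))
    (g := fun τ => k * (τ - s') ^ 2 + ψ τ) (by fun_prop) (hs.1.lt_of_ne' hzero.1)
    (hs.2.lt_of_ne hterm.1) fun ξ τ hτ => by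
      have := hmax (show ((ξ, τ), (z, s')) ∈ (univ ×ˢ Icc 0 T') ×ˢ (univ ×ˢ Icc 0 T') from
        ⟨⟨mem_univ _, hτ⟩, mem_univ _, hs'⟩)
      simp only [hΦ, mem_ofPred_eq] at this
      linarith
  have hkv := hv.of_isMax hT'T.le (x₀ := z) (t₀ := s')
    (a := fun ξ => k * ‖ξ - y‖ ^ 2) (hsqd y) (g := fun τ => k * (τ - s) ^ 2 + ψ τ) (by fun_prop)
    (hs'.1.lt_of_ne' hzero.2) (hs'.2.lt_of_ne hterm.2) fun ξ τ hτ => by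
      have := hmax (show ((y, s), (ξ, τ)) ∈ (univ ×ˢ Icc 0 T') ×ˢ (univ ×ˢ Icc 0 T') from
        ⟨⟨mem_univ _, hs⟩, mem_univ _, hτ⟩)
      simp only [hΦ, mem_ofPred_eq, norm_sub_rev y, sub_sq_comm s] at this
      linarith
  rw [hdu.deriv, hgu.gradient] at hku
  rw [hdv.deriv, hgv.gradient] at hkv
  have hneg : -(k • ((2 : ℝ) • (z - y))) = k • ((2 : ℝ) • (y - z)) := by
    rw [← smul_neg, ← smul_neg, neg_sub]
  simp only [hneg] at hkv
  have hclose := hGd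
    (a := (y, k • ((2 : ℝ) • (y - z)) + β • ((cone 1 0 y)⁻¹ • (y - 0))))
    (b := (z, k • ((2 : ℝ) • (y - z)))) (by
      refine max_lt ?_ ?_
      · rw [dist_eq_norm]
        exact hyz.trans_le hrd
      · rw [dist_eq_norm, add_sub_cancel_left, norm_smul, Real.norm_of_nonneg hβ.le]
        exact (mul_le_of_le_one_right hβ.le (norm_gradient_cone_le one_pos 0 y)).trans_lt hβd)
  rw [Real.dist_eq, abs_lt] at hclose
  dsimp only at hclose
  simp only [Nat.cast_ofNat, Nat.reduceSub, pow_one, mul_one] at hku hkv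
  linarith [hψ' s, hψ' s', hclose.1]

lemma IsParabolicSolution.initial_bounds {G : Euc N → Euc N → ℝ} {u₀ : Euc N → ℝ} {T L c : ℝ}
    {w : Euc N → ℝ → ℝ} (hw : IsParabolicSolution G u₀ T w) (hL : 0 < L)
    (hu₀ : ∀ x y, u₀ x ≤ u₀ y + L * ‖x - y‖) (hG0 : ∀ x p, 0 ≤ G x p)
    (hGc : ∀ x p, ‖p‖ ≤ L → G x p ≤ c) {x : Euc N} {t : ℝ} (ht0 : 0 ≤ t) (htT : t < T) :
    u₀ x - c * t ≤ w x t ∧ w x t ≤ u₀ x := by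
  obtain ⟨M, hM⟩ := hw.2.2.1
  constructor
  · have := hw.isSubsolution_neg.le_of_le_cone (b := -u₀ x) (c := c) (y := x) hw.2.1.neg
      (fun y s h1 h2 => by rw [abs_neg]; exact hM y s h1 h2) hL
      (fun y p hp => by linarith [hGc y (-p) (by rwa [norm_neg])])
      (fun y => by rw [hw.1, norm_sub_rev]; linarith [hu₀ x y]) ht0 htT
    linarith
  · have := hw.isSubsolution.le_of_le_cone (b := u₀ x) (c := 0) (y := x) hw.2.1 hM hL
      (fun y p _ => by linarith [hG0 y p]) (fun y => by rw [hw.1]; exact hu₀ y x) ht0 htT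
    linarith

lemma IsParabolicSolution.time_bounds {G : Euc N → Euc N → ℝ} {u₀ : Euc N → ℝ} {T L c : ℝ}
    {w : Euc N → ℝ → ℝ} (hw : IsParabolicSolution G u₀ T w)
    (hG : UniformContinuous fun z : Euc N × Euc N => G z.1 z.2) (hL : 0 < L)
    (hu₀ : ∀ x y, u₀ x ≤ u₀ y + L * ‖x - y‖) (hG0 : ∀ x p, 0 ≤ G x p)
    (hGc : ∀ x p, ‖p‖ ≤ L → G x p ≤ c) {x : Euc N} {t h : ℝ} (ht0 : 0 ≤ t) (hh : 0 ≤ h)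
    (htT : t + h < T) : w x t - c * h ≤ w x (t + h) ∧ w x (t + h) ≤ w x t := by
  obtain ⟨M, hM⟩ := hw.2.2.1
  have hc : 0 ≤ c := (hG0 0 0).trans (hGc 0 0 (by simpa using hL.le))
  have hshift : ContinuousOn (fun q : Euc N × ℝ => w q.1 (q.2 + h))
      {q | 0 ≤ q.2 ∧ q.2 < T - h} :=
    hw.2.1.comp (f := fun q : Euc N × ℝ => (q.1, q.2 + h)) (by fun_prop)
      fun q hq => ⟨add_nonneg hq.1 hh, lt_sub_iff_add_lt.1 hq.2⟩
  have hcont : ContinuousOn (fun q : Euc N × ℝ => w q.1 q.2) {q | 0 ≤ q.2 ∧ q.2 < T - h} :=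
    hw.2.1.mono fun q hq => ⟨hq.1, hq.2.trans_le (by linarith)⟩
  have hsub : ∀ {H : Euc N → Euc N → ℝ} {v : Euc N → ℝ → ℝ}, IsSubsolution H T v →
      IsSubsolution H (T - h) v := by
    rintro H v hv a g ha hg x₀ t₀ h0 h1 ⟨δ, hδ, hmax⟩
    refine hv a g ha hg x₀ t₀ h0 (by linarith) ⟨min δ (T - h - t₀), lt_min hδ (by linarith),
      fun y s hy hs hs0 _ => hmax y s (hy.trans_le (min_le_left _ _))
        (hs.trans_le (min_le_left _ _)) hs0 ?_⟩
    linarith [(abs_lt.1 (hs.trans_le (min_le_right _ _))).2]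
  have hinit : ∀ y s, 0 ≤ s → s < T → u₀ y - c * s ≤ w y s ∧ w y s ≤ u₀ y := fun y s h1 h2 =>
    hw.initial_bounds hL hu₀ hG0 hGc h1 h2
  have habs : ∀ t s : ℝ, 0 ≤ t → 0 ≤ s → (t = 0 ∨ s = 0) → s ≤ |t - s| := by
    rintro t s h1 h2 (rfl | rfl)
    · rw [zero_sub, abs_neg]
      exact le_abs_self s
    · exact abs_nonneg _
  have hLc : ∀ (y z : Euc N) (s s' : ℝ), 0 ≤ s → 0 ≤ s' → (s = 0 ∨ s' = 0) →
      L * ‖y - z‖ + c * s' ≤ (L + c) * (‖y - z‖ + |s - s'|) := by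
    intro y z s s' h1 h2 h3
    have h4 := mul_le_mul_of_nonneg_left (habs s s' h1 h2 h3) hc
    have h5 : 0 ≤ c * ‖y - z‖ := by positivity
    have h6 : 0 ≤ L * |s - s'| := by positivity
    linarith
  constructor
  · have := (hsub hw.isSubsolution).add_le (A := c * h) (L := L + c) (x := x) (t := t) hG
      (hw.isSubsolution_neg.shift hh) hcont hshift.neg
      (fun y s h1 h2 => hM y s h1 (by linarith))
      (fun y s h1 h2 => by rw [abs_neg]; exact hM y (s + h) (by linarith) (by linarith))
      (by positivity) (fun y z s s' h1 h2 h3 h4 h5 => by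
        have h6 := (hinit y s h1 (by linarith)).2
        have h7 := (hinit z (s' + h) (by linarith) (by linarith)).1
        linarith [hu₀ y z, hLc y z s s' h1 h3 h5]) ht0 (by linarith)
    linarith
  · have := (hw.isSubsolution.shift hh).add_le (A := 0) (L := L + c) (x := x) (t := t) hG
      (hsub hw.isSubsolution_neg) hshift hcont.neg
      (fun y s h1 h2 => hM y (s + h) (by linarith) (by linarith))
      (fun y s h1 h2 => by rw [abs_neg]; exact hM y s h1 (by linarith))
      (by positivity) (fun y z s s' h1 h2 h3 h4 h5 => by
        have h6 := (hinit y (s + h) (by linarith) (by linarith)).2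
        have h7 := (hinit z s' h3 (by linarith)).1
        linarith [hu₀ y z, hLc y z s s' h1 h3 h5]) ht0 (by linarith)
    linarith

/-- A lower bound on the time derivative of a subsolution of a coercive equation gives a Lipschitz
bound in space. -/
lemma IsSubsolution.sub_le_of_coercive {G : Euc N → Euc N → ℝ} {T M C K : ℝ} {w : Euc N → ℝ → ℝ}
    (hw : IsSubsolution G T w)
    (hwc : ContinuousOn (fun q : Euc N × ℝ => w q.1 q.2) {q | 0 ≤ q.2 ∧ q.2 < T})
    (hM : ∀ x t, 0 ≤ t → t < T → |w x t| ≤ M)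
    (htime : ∀ x t h, 0 ≤ t → 0 ≤ h → t + h < T → w x t - C * h ≤ w x (t + h))
    (hK : 0 ≤ K) (hG : ∀ x p, G x p ≤ C → ‖p‖ ≤ K) {x y : Euc N} {t : ℝ} (ht0 : 0 < t)
    (htT : t < T) : w x t - w y t ≤ K * ‖x - y‖ := by
  suffices h : ∀ e > 0, w x t - w y t ≤ (K + e) * ‖x - y‖ + e by
    refine le_of_forall_pos_le_add fun e he => ?_
    have h1 := h (e / (‖x - y‖ + 1)) (by positivity)
    have h2 : e / (‖x - y‖ + 1) * (‖x - y‖ + 1) = e := div_mul_cancel₀ _ (by positivity)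
    linarith
  intro e he
  have hM0 : 0 ≤ M := (abs_nonneg _).trans (hM x t ht0.le htT)
  obtain ⟨δ, hδ, hδ0, hδT, hδw⟩ : ∃ δ, 0 < δ ∧ δ < t ∧ t + δ < T ∧
      ∀ z s, ‖z - y‖ < δ → |s - t| < δ → w z s ≤ w y t + e := by
    obtain ⟨d, hd, hdw⟩ := Metric.continuousOn_iff.1 hwc (y, t) ⟨ht0.le, htT⟩ e he
    refine ⟨min d (min (t / 2) ((T - t) / 2)), by have := sub_pos.2 htT; positivity, ?_, ?_, ?_⟩
    · linarith [min_le_right d (min (t / 2) ((T - t) / 2)), min_le_left (t / 2) ((T - t) / 2)]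
    · linarith [min_le_right d (min (t / 2) ((T - t) / 2)), min_le_right (t / 2) ((T - t) / 2)]
    · intro z s hz hs
      have h1 := hs.trans_le ((min_le_right _ _).trans (min_le_left _ _))
      have h2 := hs.trans_le ((min_le_right _ _).trans (min_le_right _ _))
      have h3 := hdw (z, s) ⟨by linarith [(abs_lt.1 h1).1], by linarith [(abs_lt.1 h2).2]⟩ (by
        rw [Prod.dist_eq, dist_eq_norm, Real.dist_eq]
        exact max_lt (hz.trans_le (min_le_left _ _)) (hs.trans_le (min_le_left _ _)))
      rw [Real.dist_eq] at h3
      linarith [(abs_lt.1 h3).2]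
  have hKe : 0 < K + e := by linarith
  obtain ⟨ρ, hρ, hρδ⟩ : ∃ ρ, 0 < ρ ∧ K * ρ < e * δ := by
    refine ⟨e * δ / (K + 1), by positivity, ?_⟩
    rw [mul_div_assoc', div_lt_iff₀ (by positivity)]
    nlinarith [mul_pos he hδ]
  obtain ⟨B, hB⟩ : ∃ B, B = 2 * M + (K + e) * (ρ + ‖x - y‖) := ⟨_, rfl⟩
  have hB0 : 0 ≤ B := by rw [hB]; positivity
  obtain ⟨k, hk, hkδ⟩ : ∃ k, 0 < k ∧ B < k * δ ^ 2 := by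
    refine ⟨(B + 1) / δ ^ 2, by positivity, ?_⟩
    rw [div_mul_cancel₀ _ (by positivity)]
    linarith
  have hIcc : ∀ s ∈ Icc (t - δ) (t + δ), 0 ≤ s ∧ s < T := fun s hs =>
    ⟨by linarith [hs.1], by linarith [hs.2]⟩
  set Φ : Euc N × ℝ → ℝ := fun q => w q.1 q.2 - ((K + e) * cone ρ y q.1 + k * (q.2 - t) ^ 2) with hΦ
  have hmem0 : (x, t) ∈ univ ×ˢ Icc (t - δ) (t + δ) := ⟨mem_univ _, by simp [hδ.le]⟩
  have hcont : ContinuousOn Φ (univ ×ˢ Icc (t - δ) (t + δ)) := by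
    refine (hwc.mono fun q hq => hIcc _ hq.2).sub (Continuous.continuousOn ?_)
    have h1 := (contDiff_cone hρ y).continuous
    fun_prop
  have hlarge : ∀ z s, s ∈ Icc (t - δ) (t + δ) → Φ (x, t) ≤ Φ (z, s) →
      (K + e) * cone ρ y z + k * (s - t) ^ 2 ≤ B := by
    intro z s hs hle
    simp only [hΦ, sub_self] at hle
    have h1 := (abs_le.1 (hM z s (hIcc s hs).1 (hIcc s hs).2)).2
    have h2 := (abs_le.1 (hM x t ht0.le htT)).1
    have h3 := mul_le_mul_of_nonneg_left (cone_le hρ.le y x) hKe.le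
    linarith
  obtain ⟨⟨z, s⟩, ⟨-, hs⟩, hmax⟩ := exists_isMaxOn_of_bounded
    (isClosed_univ.prod isClosed_Icc) hcont hmem0 (max (B / (K + e) + ‖x - y‖) (2 * δ)) (by
      rintro ⟨z, s⟩ ⟨-, hs⟩ hle
      refine max_le_max ?_ ?_
      · have h1 : 0 ≤ k * (s - t) ^ 2 := by positivity
        have h2 : ‖z - y‖ ≤ B / (K + e) := by
          rw [le_div_iff₀ hKe]
          linarith [hlarge z s hs hle, mul_le_mul_of_nonneg_left (norm_le_cone ρ y z) hKe.le]
        rw [dist_eq_norm]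
        have h3 := norm_sub_le (z - y) (x - y)
        rw [sub_sub_sub_cancel_right] at h3
        linarith
      · exact (Real.dist_le_of_mem_Icc hs hmem0.2).trans (by linarith))
  have hl := hlarge z s hs (hmax hmem0)
  have hst : |s - t| < δ := by
    by_contra! h
    have h1 : k * δ ^ 2 ≤ k * |s - t| ^ 2 := by gcongr
    rw [sq_abs] at h1
    linarith [mul_pos hKe (cone_pos hρ y z)]
  have hs0 := (hIcc s hs).1
  have hsT := (hIcc s hs).2
  have hsδ := abs_lt.1 hst
  have hder : HasDerivAt (fun τ => k * (τ - t) ^ 2) (k * (2 * (s - t))) s := by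
    simpa using (((hasDerivAt_id s).sub_const t).pow 2).const_mul k
  have hgrad : HasGradientAt (fun ξ => (K + e) * cone ρ y ξ)
      ((K + e) • ((cone ρ y z)⁻¹ • (z - y))) z := by
    rw [hasGradientAt_iff_hasFDerivAt, map_smul]
    exact (hasGradientAt_cone hρ y z).hasFDerivAt.const_mul (K + e)
  have key := hw (fun ξ => (K + e) * cone ρ y ξ) (fun τ => k * (τ - t) ^ 2)
    (contDiff_const.mul (contDiff_cone hρ y)) (by fun_prop) z s (by linarith) hsT
    ⟨δ - |s - t|, by linarith, fun ξ τ _ hτ _ _ => by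
      have h1 : |τ - t| ≤ δ := by linarith [abs_sub_le τ s t]
      exact hmax (show (ξ, τ) ∈ univ ×ˢ Icc (t - δ) (t + δ) from
        ⟨mem_univ _, by linarith [(abs_le.1 h1).1], by linarith [(abs_le.1 h1).2]⟩)⟩
  rw [hder.deriv, hgrad.gradient] at key
  have htime' : -C ≤ k * (2 * (s - t)) := by
    refine le_of_forall_pos_le_add fun a ha => ?_
    obtain ⟨h, hh, hha, hhδ⟩ : ∃ h, 0 < h ∧ k * h ≤ a ∧ s + h ≤ t + δ := by
      have := sub_pos.2 hsδ.2
      refine ⟨min (a / k) (δ - (s - t)), by positivity, ?_, ?_⟩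
      · rw [← le_div_iff₀' hk]
        exact min_le_left _ _
      · linarith [min_le_right (a / k) (δ - (s - t))]
    have h1 := hmax (show (z, s + h) ∈ univ ×ˢ Icc (t - δ) (t + δ) from
      ⟨mem_univ _, by linarith, hhδ⟩)
    simp only [hΦ, mem_ofPred_eq] at h1
    have h2 := htime z s h hs0 hh.le (by linarith)
    have h3 : -C * h ≤ (k * (2 * (s - t)) + k * h) * h := by linarith
    have h4 := le_of_mul_le_mul_right h3 hh
    linarith
  have hP := hG z _ (show G z ((K + e) • ((cone ρ y z)⁻¹ • (z - y))) ≤ C by linarith)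
  have hc := cone_pos hρ y z
  rw [norm_smul, norm_smul, norm_inv, Real.norm_of_nonneg hKe.le, Real.norm_of_nonneg hc.le,
    mul_left_comm, inv_mul_le_iff₀ hc] at hP
  have hzy : ‖z - y‖ < δ := by
    have h1 := mul_le_mul_of_nonneg_left (cone_le hρ.le y z) hK
    exact lt_of_mul_lt_mul_left (a := e) (by linarith) he.le
  have h1 := hmax hmem0
  simp only [hΦ, mem_ofPred_eq, sub_self] at h1
  have h2 := mul_le_mul_of_nonneg_left (cone_le hρ.le y x) hKe.le
  have h3 := mul_le_mul_of_nonneg_left (le_cone ρ y z) hKe.le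
  have h4 : 0 ≤ k * (s - t) ^ 2 := by positivity
  linarith [hδw z s hzy hst]

lemma IsZPeriodic.uniformContinuous {σ : Euc N → ℝ} (hσp : IsZPeriodic σ) (hσ : Continuous σ) :
    UniformContinuous σ := by
  have hK := (isCompact_closedBall (0 : Euc N) (√N + 1)).uniformContinuousOn_of_continuous
    hσ.continuousOn
  rw [Metric.uniformContinuousOn_iff] at hK
  rw [Metric.uniformContinuous_iff]
  intro e he
  obtain ⟨d, hd, h⟩ := hK e he
  refine ⟨min d 1, by positivity, fun x y hxy => ?_⟩
  set z : Fin N → ℤ := fun i => -⌊x i⌋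
  have hx : ‖x + intVec z‖ ≤ √N := by
    rw [EuclideanSpace.norm_eq]
    refine Real.sqrt_le_sqrt ?_
    calc ∑ i, ‖(x + intVec z) i‖ ^ 2 ≤ ∑ _i : Fin N, (1 : ℝ) := by
          refine Finset.sum_le_sum fun i _ => ?_
          have h1 : (x + intVec z) i = Int.fract (x i) := by
            simp [intVec, z, Int.fract, sub_eq_add_neg]
          rw [h1, Real.norm_of_nonneg (Int.fract_nonneg _)]
          exact pow_le_one₀ (Int.fract_nonneg _) (Int.fract_lt_one _).le
      _ = N := by simp
  have hd' : dist (x + intVec z) (y + intVec z) < min d 1 := by rwa [dist_add_right]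
  have hy : ‖y + intVec z‖ ≤ √N + 1 := by
    have h1 := norm_le_norm_add_norm_sub' (y + intVec z) (x + intVec z)
    rw [← dist_eq_norm, dist_comm] at h1
    linarith [hd'.trans_le (min_le_right _ _)]
  have := h (x + intVec z) (by simp; linarith) (y + intVec z) (by simpa using hy)
    (hd'.trans_le (min_le_left _ _))
  rwa [hσp, hσp] at this

lemma uniformContinuous_mul_norm {s : Euc N → ℝ} {m : ℝ → ℝ} {B : ℝ} {Λ : NNReal}
    (hs : UniformContinuous s) (hB : ∀ x, |s x| ≤ B) (hm : LipschitzOnWith Λ m (Ici 0))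
    (hm1 : ∀ r, 0 ≤ r → |m r| ≤ 1) :
    UniformContinuous fun z : Euc N × Euc N => s z.1 * m ‖z.2‖ := by
  have hB0 : 0 ≤ B := (abs_nonneg _).trans (hB 0)
  rw [Metric.uniformContinuous_iff] at hs ⊢
  intro e he
  obtain ⟨d, hd, h⟩ := hs (e / 2) (by positivity)
  refine ⟨min d (e / (2 * (B * Λ + 1))), by positivity, ?_⟩
  rintro ⟨x, p⟩ ⟨y, q⟩ hxy
  rw [Prod.dist_eq, max_lt_iff] at hxy
  have h1 := h (hxy.1.trans_le (min_le_left _ _))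
  have h2 := hxy.2.trans_le (min_le_right _ _)
  have h3 := hm.dist_le_mul ‖p‖ (norm_nonneg p) ‖q‖ (norm_nonneg q)
  simp only [dist_eq_norm, Real.norm_eq_abs] at h1 h2 h3 ⊢
  have h4 := h3.trans (mul_le_mul_of_nonneg_left (abs_norm_sub_norm_le p q) Λ.2)
  rw [lt_div_iff₀ (by positivity)] at h2
  calc |s x * m ‖p‖ - s y * m ‖q‖| = |(s x - s y) * m ‖p‖ + s y * (m ‖p‖ - m ‖q‖)| := by
        congr 1; ring
    _ ≤ |s x - s y| * |m ‖p‖| + |s y| * |m ‖p‖ - m ‖q‖| := by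
        rw [← abs_mul, ← abs_mul]
        exact abs_add_le _ _
    _ ≤ |s x - s y| * 1 + B * (Λ * ‖p - q‖) := by
        gcongr
        · exact hm1 _ (norm_nonneg p)
        · exact hB y
    _ < e := by nlinarith [norm_nonneg (p - q), h1, h2]

end Viscosity

/-- Regularity (equi-Lipschitz estimates in time and space) of
solutions of the oscillating problem, under `m(Lip[u₀]) < σ̲/σ̄`.
Here `K` is the constant `m⁻¹((σ̄/σ̲) m(L₀))`. -/
theorem oscillating_problem_regularity {N : ℕ} (hN : 1 ≤ N)
    (σ : Euc N → ℝ) (m : ℝ → ℝ)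
    (hσc : Continuous σ) (hσp : IsZPeriodic σ) (hσpos : ∀ x, 0 < σ x)
    (hm01 : ∀ r : ℝ, 0 ≤ r → 0 < m r ∧ m r < 1)
    (hmLip : ∃ L : NNReal, LipschitzOnWith L m (Set.Ici 0))
    (hmmono : StrictMonoOn m (Set.Ici 0))
    (hmlim : Tendsto m atTop (nhds 1))
    (σmax σmin : ℝ)
    (hσmax : IsGreatest (Set.range σ) σmax) (hσmin : IsLeast (Set.range σ) σmin)
    (T : ℝ) (hT : 0 < T)
    (u₀ : Euc N → ℝ) (hu₀b : ∃ M : ℝ, ∀ x, |u₀ x| ≤ M)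
    (L₀ : ℝ) (hL₀ : 0 ≤ L₀) (hu₀lip : LipschitzWith (Real.toNNReal L₀) u₀)
    (hsmall : m L₀ < σmin / σmax)
    (K : ℝ) (hK0 : 0 ≤ K) (hK : m K = σmax / σmin * m L₀) :
    ∀ ε : ℝ, 0 < ε → ∀ w : Euc N → ℝ → ℝ,
      IsParabolicSolution (fun x p => σ (ε⁻¹ • x) * m ‖p‖) u₀ T w →
      ∀ (x y : Euc N) (t s : ℝ), 0 ≤ t → t < T → 0 ≤ s → s < T →
        |w x t - w x s| ≤ σmax * m L₀ * |t - s| ∧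
        |w x t - w y t| ≤ K * ‖x - y‖ := by
  intro ε _ w hw
  obtain ⟨Λ, hΛ⟩ := hmLip
  set G : Euc N → Euc N → ℝ := fun x p => σ (ε⁻¹ • x) * m ‖p‖ with hGdef
  have hle : ∀ x, σ x ≤ σmax := fun x => hσmax.2 (mem_range_self x)
  have hge : ∀ x, σmin ≤ σ x := fun x => hσmin.2 (mem_range_self x)
  have hmin : 0 < σmin := by
    obtain ⟨x, hx⟩ := hσmin.1
    exact hx ▸ hσpos x
  have hmax : 0 < σmax := (hσpos 0).trans_le (hle 0)
  have hG : UniformContinuous fun z : Euc N × Euc N => G z.1 z.2 :=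
    uniformContinuous_mul_norm (B := σmax)
      ((hσp.uniformContinuous hσc).comp (uniformContinuous_const_smul ε⁻¹))
      (fun x => (abs_of_pos (hσpos _)).trans_le (hle _)) hΛ
      (fun r hr => (abs_of_pos (hm01 r hr).1).trans_le (hm01 r hr).2.le)
  have hG0 : ∀ x p, 0 ≤ G x p := fun x p =>
    (mul_pos (hσpos _) (hm01 _ (norm_nonneg p)).1).le
  have hGc : ∀ L, 0 ≤ L → ∀ x p, ‖p‖ ≤ L → G x p ≤ σmax * m L := fun L hL x p hp =>
    mul_le_mul (hle _) (hmmono.monotoneOn (norm_nonneg p) hL hp) (hm01 _ (norm_nonneg p)).1.le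
      hmax.le
  have hu₀ : ∀ x y, u₀ x ≤ u₀ y + L₀ * ‖x - y‖ := by
    intro x y
    have h := hu₀lip.dist_le_mul x y
    rw [Real.dist_eq, dist_eq_norm, Real.coe_toNNReal _ hL₀] at h
    linarith [le_abs_self (u₀ x - u₀ y)]
  have htime : ∀ x t h, 0 ≤ t → 0 ≤ h → t + h < T →
      w x t - σmax * m L₀ * h ≤ w x (t + h) ∧ w x (t + h) ≤ w x t := by
    intro x t h ht hh htT
    have hL : ∀ e > 0, w x t - σmax * m (L₀ + e) * h ≤ w x (t + h) ∧ w x (t + h) ≤ w x t :=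
      fun e he => hw.time_bounds hG (by positivity)
        (fun x y => (hu₀ x y).trans (by gcongr; linarith)) hG0 (hGc _ (by positivity)) ht hh htT
    refine ⟨?_, (hL 1 one_pos).2⟩
    have hcont : ContinuousWithinAt (fun r => w x t - σmax * m r * h) (Ioi L₀) L₀ :=
      continuousWithinAt_const.sub ((continuousWithinAt_const.mul
        ((hΛ.continuousOn L₀ hL₀).mono fun r hr => hL₀.trans (le_of_lt hr))).mul
          continuousWithinAt_const)
    refine le_of_tendsto hcont (eventually_mem_nhdsWithin.mono fun r hr => ?_)
    simpa using (hL (r - L₀) (sub_pos.2 hr)).1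
  have hcoer : ∀ x p, G x p ≤ σmax * m L₀ → ‖p‖ ≤ K := by
    intro x p hp
    refine (hmmono.le_iff_le (norm_nonneg p) hK0).1 ?_
    have h1 : σmin * m ‖p‖ ≤ G x p :=
      mul_le_mul_of_nonneg_right (hge _) (hm01 _ (norm_nonneg p)).1.le
    rw [hK, div_mul_eq_mul_div, le_div_iff₀ hmin]
    linarith
  have hLK : L₀ ≤ K := by
    refine (hmmono.le_iff_le hL₀ hK0).1 ?_
    rw [hK, div_mul_eq_mul_div, le_div_iff₀ hmin, mul_comm]
    exact mul_le_mul_of_nonneg_right ((hge 0).trans (hle 0)) (hm01 _ hL₀).1.le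
  have hspace : ∀ x y t, 0 ≤ t → t < T → w x t - w y t ≤ K * ‖x - y‖ := by
    intro x y t ht htT
    rcases ht.eq_or_lt with rfl | ht
    · rw [hw.1, hw.1]
      linarith [hu₀ x y, mul_le_mul_of_nonneg_right hLK (norm_nonneg (x - y))]
    · obtain ⟨M, hM⟩ := hw.2.2.1
      exact hw.isSubsolution.sub_le_of_coercive hw.2.1 hM
        (fun x t h h1 h2 h3 => (htime x t h h1 h2 h3).1) hK0 hcoer ht htT
  intro x y t s ht htT hs hsT
  constructor
  · wlog hts : t ≤ s generalizing t s
    · rw [abs_sub_comm, abs_sub_comm t]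
      exact this s t hs hsT ht htT (le_of_not_ge hts)
    have h1 := htime x t (s - t) ht (sub_nonneg.2 hts) (by linarith)
    rw [add_sub_cancel] at h1
    rw [abs_of_nonneg (by linarith), abs_of_nonpos (by linarith)]
    linarith
  · rw [abs_le]
    have h1 := hspace y x t ht htT
    rw [norm_sub_rev] at h1
    exact ⟨by linarith, hspace x y t ht htT⟩
end
end
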